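/- arXiv:1307.7460 — 2 statements merged into one kernel-verified Lean document; each statement's English description precedes it below -/
import Mathlib

section
/- For n ≥ 4, the automorphism group of the bicircular matroid of the wheel graph W_n is isomorphic to the dihedral group D_n of order 2n. -/
/-- A matroid automorphism, modelled as a permutation of the ambient type that fixes
every point outside the ground set and preserves independence. -/
def IsMAuto {α : Type*} (M : Matroid α) (σ : Equiv.Perm α) : Prop :=
  (∀ x ∉ M.E, σ x = x) ∧ ∀ I : Set α, M.Indep (σ '' I) ↔ M.Indep I

/-- The automorphism group of a matroid, as a subgroup of `Equiv.Perm α`. -/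
def matroidAutGroup {α : Type*} (M : Matroid α) : Subgroup (Equiv.Perm α) where
  carrier := {σ | IsMAuto M σ}
  one_mem' := ⟨fun _ _ => rfl, fun I => by simp⟩
  mul_mem' := by
    rintro σ τ ⟨hσ1, hσ2⟩ ⟨hτ1, hτ2⟩
    refine ⟨fun x hx => ?_, fun I => ?_⟩
    · simp [Equiv.Perm.mul_apply, hτ1 x hx, hσ1 x hx]
    · rw [Equiv.Perm.coe_mul, Set.image_comp, hσ2, hτ2]
  inv_mem' := by
    rintro σ ⟨hσ1, hσ2⟩
    refine ⟨fun x hx => ?_, fun I => ?_⟩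
    · have := hσ1 x hx
      simp only [Equiv.Perm.inv_def, Equiv.symm_apply_eq]
      exact this.symm
    · have h := hσ2 ((σ⁻¹ : Equiv.Perm α) '' I)
      exact (by rwa [Set.image_image, show (fun x => σ (σ⁻¹ x)) = id by
        funext x; simp, Set.image_id] at h : M.Indep I ↔ M.Indep (⇑σ⁻¹ '' I)).symm

/-- A fixing set of a matroid: a subset of the ground set whose pointwise
stabilizer in the automorphism group is trivial. -/
def IsFixingSet {α : Type*} (M : Matroid α) (A : Set α) : Prop :=
  A ⊆ M.E ∧ ∀ σ : Equiv.Perm α, IsMAuto M σ → (∀ a ∈ A, σ a = a) → σ = 1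

/-- The fixing number of a matroid: the least size of a fixing set. -/
noncomputable def fixNum {α : Type*} (M : Matroid α) : ℕ :=
  sInf {k | ∃ A : Set α, IsFixingSet M A ∧ A.Finite ∧ A.ncard = k}

/-- A circuit of a matroid: a minimal dependent subset of the ground set. -/
def MCirc {α : Type*} (M : Matroid α) (C : Set α) : Prop :=
  C ⊆ M.E ∧ ¬ M.Indep C ∧ ∀ D ⊂ C, M.Indep D

/-- The vertex support of a set of edges. -/
def edgeSupp {V : Type*} (C : Set (Sym2 V)) : Set V := {v | ∃ e ∈ C, v ∈ e}

/-- A set of edges is connected if it is nonempty and any two supported vertices are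
joined by a walk using only these edges. -/
def EdgeConn {V : Type*} (C : Set (Sym2 V)) : Prop :=
  C.Nonempty ∧ ∀ u ∈ edgeSupp C, ∀ v ∈ edgeSupp C, (SimpleGraph.fromEdgeSet C).Reachable u v

/-- The edge set of a cycle of the graph `G`. -/
def IsCycleSet {V : Type*} (G : SimpleGraph V) (C : Set (Sym2 V)) : Prop :=
  ∃ (v : V) (w : G.Walk v v), w.IsCycle ∧ C = {e | e ∈ w.edges}

/-- A bicycle of `G`: a minimal connected edge set with more edges than vertices,
equivalently a subdivision of two loops at a vertex, two loops joined by an edge,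
or three edges joining the same pair of vertices. -/
def IsBicycle {V : Type*} (G : SimpleGraph V) (C : Set (Sym2 V)) : Prop :=
  C ⊆ G.edgeSet ∧ C.Finite ∧ EdgeConn C ∧ (edgeSupp C).ncard < C.ncard ∧
    ∀ D ⊂ C, ¬ (EdgeConn D ∧ D.Finite ∧ (edgeSupp D).ncard < D.ncard)

/-- The wheel graph `W n`: hub `none` joined to all rim vertices `some i`,
with rim vertices `some i`, `some (i+1)` adjacent. -/
def wheel (n : ℕ) : SimpleGraph (Option (ZMod n)) :=
  SimpleGraph.fromRel (fun a b => a = none ∨ ∃ i : ZMod n, a = some i ∧ b = some (i + 1))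

section helpers

open Classical

/-- Connected with more edges than vertices. -/
def QQ {V : Type*} (D : Set (Sym2 V)) : Prop :=
  EdgeConn D ∧ (edgeSupp D).ncard < D.ncard

theorem indep_iff_QQ {V : Type*} [Finite V] (G : SimpleGraph V) (M : Matroid (Sym2 V))
    (hE : M.E = G.edgeSet) (hC : ∀ C, MCirc M C ↔ IsBicycle G C) (I : Set (Sym2 V)) :
    M.Indep I ↔ I ⊆ G.edgeSet ∧ ∀ D ⊆ I, ¬ QQ D := by
  haveI : Finite (Sym2 V) := inferInstance
  constructor
  · intro hI
    have hIE : I ⊆ G.edgeSet := hE ▸ hI.subset_ground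
    refine ⟨hIE, fun D hD hQ => ?_⟩
    obtain ⟨C, hCD, hmin⟩ := exists_minimal_le_of_wellFoundedLT (fun D => QQ D) D hQ
    have hb : IsBicycle G C := by
      refine ⟨(hCD.trans hD).trans hIE, Set.toFinite _, hmin.prop.1, hmin.prop.2, ?_⟩
      rintro F hF ⟨h1, _, h3⟩
      exact hF.2 (hmin.le_of_le ⟨h1, h3⟩ hF.1)
    exact ((hC C).2 hb).2.1 (hI.subset (hCD.trans hD))
  · rintro ⟨hIE, h⟩
    by_contra hI
    obtain ⟨C, hCI, hmin⟩ := exists_minimal_le_of_wellFoundedLT (fun D => ¬ M.Indep D) I hI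
    have hm : MCirc M C := by
      refine ⟨hE ▸ hCI.trans hIE, hmin.prop, fun D hD => ?_⟩
      by_contra hDI
      exact hD.2 (hmin.le_of_le hDI hD.1)
    have hb := (hC C).1 hm
    exact h C hCI ⟨hb.2.2.1, hb.2.2.2.1⟩

theorem indep_of_injOn {V : Type*} [Finite V] (G : SimpleGraph V) (M : Matroid (Sym2 V))
    (hE : M.E = G.edgeSet) (hC : ∀ C, MCirc M C ↔ IsBicycle G C) (I : Set (Sym2 V))
    (hI : I ⊆ G.edgeSet) (g : Sym2 V → V) (hg : ∀ e ∈ I, g e ∈ e) (hinj : Set.InjOn g I) :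
    M.Indep I := by
  rw [indep_iff_QQ G M hE hC]
  refine ⟨hI, fun D hD hQ => ?_⟩
  have := Set.ncard_le_ncard_of_injOn g (s := D) (t := edgeSupp D)
    (fun e he => ⟨e, he, hg e (hD he)⟩) (hinj.mono hD) (Set.toFinite _)
  exact absurd hQ.2 (not_lt.2 this)

theorem edgeSupp_image {V : Type*} (g : V → V) (D : Set (Sym2 V)) :
    edgeSupp (Sym2.map g '' D) = g '' edgeSupp D := by
  ext v
  simp only [edgeSupp, Set.mem_setOf_eq, Set.mem_image]
  constructor
  · rintro ⟨_, ⟨e, he, rfl⟩, hv⟩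
    obtain ⟨w, hw, rfl⟩ := Sym2.mem_map.1 hv
    exact ⟨w, ⟨e, he, hw⟩, rfl⟩
  · rintro ⟨w, ⟨e, he, hw⟩, rfl⟩
    exact ⟨_, ⟨e, he, rfl⟩, Sym2.mem_map.2 ⟨w, hw, rfl⟩⟩

theorem QQ_image {V : Type*} [Finite V] (g : V → V) (hg : Function.Injective g)
    (D : Set (Sym2 V)) (h : QQ D) : QQ (Sym2.map g '' D) := by
  obtain ⟨⟨h1, h2⟩, h3⟩ := h
  refine ⟨⟨h1.image _, ?_⟩, ?_⟩
  · rw [edgeSupp_image]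
    rintro _ ⟨u, hu, rfl⟩ _ ⟨v, hv, rfl⟩
    let φ : SimpleGraph.fromEdgeSet D →g SimpleGraph.fromEdgeSet (Sym2.map g '' D) :=
      ⟨g, by
        intro a b hab
        rw [SimpleGraph.fromEdgeSet_adj] at hab ⊢
        exact ⟨⟨_, hab.1, rfl⟩, fun h => hab.2 (hg h)⟩⟩
    exact (h2 u hu v hv).map φ
  · rw [edgeSupp_image, Set.ncard_image_of_injective _ hg,
      Set.ncard_image_of_injective _ (Sym2.map.injective hg)]
    exact h3

variable {n : ℕ}

/-- spoke -/
def bE (i : ZMod n) : Sym2 (Option (ZMod n)) := s(none, some i)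
/-- rim edge -/
def aE (i : ZMod n) : Sym2 (Option (ZMod n)) := s(some i, some (i + 1))

theorem zmod_ne (hn : 4 ≤ n) : (1 : ZMod n) ≠ 0 ∧ (2 : ZMod n) ≠ 0 := by
  constructor
  · intro h
    have : ((1 : ℕ) : ZMod n) = 0 := by exact_mod_cast h
    rw [ZMod.natCast_eq_zero_iff] at this
    have := Nat.le_of_dvd (by norm_num) this
    omega
  · intro h
    have : ((2 : ℕ) : ZMod n) = 0 := by exact_mod_cast h
    rw [ZMod.natCast_eq_zero_iff] at this
    have := Nat.le_of_dvd (by norm_num) this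
    omega

theorem mem_wheel (hn : 4 ≤ n) (e : Sym2 (Option (ZMod n))) :
    e ∈ (wheel n).edgeSet ↔ (∃ i, e = bE i) ∨ ∃ i, e = aE i := by
  have h1 := (zmod_ne hn).1
  constructor
  · induction e with
    | h x y =>
      rw [SimpleGraph.mem_edgeSet, wheel, SimpleGraph.fromRel_adj]
      rintro ⟨hne, (rfl | ⟨i, rfl, rfl⟩) | (rfl | ⟨i, rfl, rfl⟩)⟩
      · cases y with
        | none => exact absurd rfl hne
        | some j => exact Or.inl ⟨j, rfl⟩
      · exact Or.inr ⟨i, rfl⟩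
      · cases x with
        | none => exact absurd rfl hne
        | some j => exact Or.inl ⟨j, Sym2.eq_swap⟩
      · exact Or.inr ⟨i, Sym2.eq_swap⟩
  · rintro (⟨i, rfl⟩ | ⟨i, rfl⟩)
    · rw [bE, SimpleGraph.mem_edgeSet, wheel, SimpleGraph.fromRel_adj]
      simp
    · rw [aE, SimpleGraph.mem_edgeSet, wheel, SimpleGraph.fromRel_adj]
      refine ⟨by simpa using h1, Or.inl (Or.inr ⟨i, rfl, rfl⟩)⟩

theorem bE_mem (hn : 4 ≤ n) (i : ZMod n) : bE i ∈ (wheel n).edgeSet :=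
  (mem_wheel hn _).2 (Or.inl ⟨i, rfl⟩)
theorem aE_mem (hn : 4 ≤ n) (i : ZMod n) : aE i ∈ (wheel n).edgeSet :=
  (mem_wheel hn _).2 (Or.inr ⟨i, rfl⟩)

theorem bE_inj : Function.Injective (bE (n := n)) := by
  intro i j h
  simpa [bE] using h

theorem aE_inj (hn : 4 ≤ n) : Function.Injective (aE (n := n)) := by
  intro i j h
  have h2 := (zmod_ne hn).2
  simp only [aE, Sym2.eq_iff, Option.some.injEq] at h
  rcases h with h | ⟨h, h'⟩
  · exact h.1
  · exfalso
    apply h2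
    have : i + 2 = i := by
      calc i + 2 = (i + 1) + 1 := by ring
        _ = i := by rw [h', h]
    simpa using this

theorem bE_ne_aE (i j : ZMod n) : bE i ≠ aE j := by
  simp [bE, aE]

/-- star of rim vertex -/
def rstar (i : ZMod n) : Set (Sym2 (Option (ZMod n))) := {e ∈ (wheel n).edgeSet | some i ∈ e}

theorem rstar_eq (hn : 4 ≤ n) (i : ZMod n) : rstar i = {bE i, aE i, aE (i - 1)} := by
  ext e
  simp only [rstar, Set.mem_setOf_eq, Set.mem_insert_iff, Set.mem_singleton_iff]
  constructor
  · rintro ⟨he, hi⟩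
    rcases (mem_wheel hn e).1 he with ⟨j, rfl⟩ | ⟨j, rfl⟩
    · left
      simp only [bE, Sym2.mem_iff, reduceCtorEq, Option.some.injEq, false_or] at hi
      rw [hi]
    · simp only [aE, Sym2.mem_iff, Option.some.injEq] at hi
      rcases hi with rfl | rfl
      · simp
      · simp
  · rintro (rfl | rfl | rfl)
    · exact ⟨bE_mem hn _, by simp [bE]⟩
    · exact ⟨aE_mem hn _, by simp [aE]⟩
    · exact ⟨aE_mem hn _, by simp [aE]⟩

theorem rstar_ncard (hn : 4 ≤ n) (i : ZMod n) : (rstar i).ncard = 3 := by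
  rw [rstar_eq hn, Set.ncard_eq_three]
  refine ⟨_, _, _, bE_ne_aE _ _, bE_ne_aE _ _, ?_, rfl⟩
  intro h
  have := aE_inj hn h
  apply (zmod_ne hn).1
  have h2 : (i - 1) + 1 = i + 1 := by rw [← this]
  simpa using h2

theorem shift_card [NeZero n] (R : Finset (ZMod n)) (h0 : R.Nonempty) (h1 : R ≠ Finset.univ) :
    R.card + 1 ≤ (R ∪ R.image (fun x => x - 1)).card := by
  by_contra hcon
  have hsub : R ⊆ R ∪ R.image (fun x => x - 1) := Finset.subset_union_left
  have heq := Finset.eq_of_subset_of_card_le hsub (by omega)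
  have hcl : ∀ x ∈ R, x - 1 ∈ R := by
    intro x hx
    rw [heq]
    exact Finset.mem_union_right _ (Finset.mem_image_of_mem _ hx)
  obtain ⟨r, hr⟩ := h0
  have hk : ∀ k : ℕ, r - k ∈ R := by
    intro k
    induction k with
    | zero => simpa using hr
    | succ k ih =>
      have := hcl _ ih
      push_cast
      rwa [← sub_sub]
  apply h1
  ext x
  simp only [Finset.mem_univ, iff_true]
  have := hk (r - x).val
  rw [ZMod.natCast_zmod_val] at this
  simpa using this

/-- 3-element sets whose complement is not spanning -/
def Triad (M : Matroid (Sym2 (Option (ZMod n)))) (T : Set (Sym2 (Option (ZMod n)))) : Prop :=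
  T ⊆ M.E ∧ T.ncard = 3 ∧ ∀ I ⊆ M.E \ T, M.Indep I → I.ncard ≠ n + 1

theorem touch_card [NeZero n] (hn : 4 ≤ n) (S : Finset (Option (ZMod n))) (hS : S.Nonempty)
    (hS1 : ∀ i, S ≠ {some i}) (N : Finset (Sym2 (Option (ZMod n))))
    (hN : ∀ e ∈ (wheel n).edgeSet, (∃ v ∈ S, v ∈ e) → e ∈ N) : S.card + 3 ≤ N.card := by
  set R : Finset (ZMod n) := Finset.univ.filter (fun i => some i ∈ S) with hR
  have hRm : ∀ i, i ∈ R ↔ some i ∈ S := by simp [hR]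
  have hSR : R.image some = S.erase none := by
    ext v
    cases v <;> simp [hRm]
  have hRc : R.card = (S.erase none).card := by
    rw [← hSR, Finset.card_image_of_injective _ (Option.some_injective _)]
  set A := R ∪ R.image (fun x => x - 1) with hA
  have hdisj : ∀ B : Finset (ZMod n), Disjoint (B.image bE) (A.image aE) := by
    intro B
    rw [Finset.disjoint_left]
    intro e h1 h2
    obtain ⟨i, _, rfl⟩ := Finset.mem_image.1 h1
    obtain ⟨j, _, hj⟩ := Finset.mem_image.1 h2
    exact bE_ne_aE _ _ hj.symm
  have hcount : ∀ B : Finset (ZMod n), (∀ i ∈ B, bE i ∈ N) → B.card + A.card ≤ N.card := by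
    intro B hB
    rw [← Finset.card_image_of_injective B bE_inj, ← Finset.card_image_of_injective A (aE_inj hn),
      ← Finset.card_union_of_disjoint (hdisj B)]
    apply Finset.card_le_card
    intro e he
    rcases Finset.mem_union.1 he with he | he
    · obtain ⟨i, hi, rfl⟩ := Finset.mem_image.1 he
      exact hB i hi
    · obtain ⟨i, hi, rfl⟩ := Finset.mem_image.1 he
      apply hN _ (aE_mem hn i)
      rcases Finset.mem_union.1 hi with hi | hi
      · exact ⟨some i, (hRm i).1 hi, by simp [aE]⟩
      · obtain ⟨j, hj, rfl⟩ := Finset.mem_image.1 hi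
        exact ⟨some j, (hRm j).1 hj, by simp [aE]⟩
  have hu : (Finset.univ : Finset (ZMod n)).card = n := by simp [ZMod.card]
  have hRA : R.card ≤ A.card := Finset.card_le_card Finset.subset_union_left
  by_cases hnone : none ∈ S
  · have h1 := hcount Finset.univ (fun i _ => hN _ (bE_mem hn i) ⟨none, hnone, by simp [bE]⟩)
    have h2 : S.card = R.card + 1 := by
      rw [hRc, Finset.card_erase_add_one hnone]
    rw [hu] at h1
    rcases R.eq_empty_or_nonempty with h0 | h0
    · rw [h0, Finset.card_empty] at h2
      omega
    · by_cases h3 : R = Finset.univ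
      · rw [h3, hu] at h2 hRA
        omega
      · have h5 : R.card + 1 ≤ A.card := shift_card R h0 h3
        omega
  · have h1 := hcount R (fun i hi => hN _ (bE_mem hn i) ⟨some i, (hRm i).1 hi, by simp [bE]⟩)
    have h2 : S.card = R.card := by
      rw [hRc, Finset.erase_eq_of_notMem hnone]
    have h0 : R.Nonempty := by
      rw [← Finset.card_pos, ← h2, Finset.card_pos]; exact hS
    by_cases h3 : R = Finset.univ
    · rw [h3, hu] at h2 hRA h1
      omega
    · have h5 : R.card + 1 ≤ A.card := shift_card R h0 h3
      have h4 : R.card ≠ 1 := by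
        intro h
        rw [← h2, Finset.card_eq_one] at h
        obtain ⟨v, hv⟩ := h
        cases v with
        | none => exact hnone (by simp [hv])
        | some i => exact hS1 i hv
      have := Finset.card_pos.2 h0
      omega

theorem triad_is_rstar (hn : 4 ≤ n) (M : Matroid (Sym2 (Option (ZMod n))))
    (hE : M.E = (wheel n).edgeSet) (hC : ∀ C, MCirc M C ↔ IsBicycle (wheel n) C)
    (T : Set (Sym2 (Option (ZMod n)))) (hT : Triad M T) : ∃ i, T = rstar i := by
  haveI : NeZero n := ⟨by omega⟩
  by_contra hcon
  push Not at hcon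
  obtain ⟨hTE, hT3, hTI⟩ := hT
  let t : Option (ZMod n) → Finset (Sym2 (Option (ZMod n))) :=
    fun v => Finset.univ.filter (fun e => e ∈ (wheel n).edgeSet ∧ v ∈ e ∧ e ∉ T)
  have hall : ∀ S : Finset (Option (ZMod n)), S.card ≤ (S.biUnion t).card := by
    intro S
    rcases S.eq_empty_or_nonempty with rfl | hS
    · simp
    by_cases hS1 : ∃ i, S = {some i}
    · obtain ⟨i, rfl⟩ := hS1
      rw [Finset.card_singleton, Finset.singleton_biUnion, Nat.succ_le_iff, Finset.card_pos]
      have : ¬ rstar i ⊆ T := by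
        intro h
        exact hcon i (Set.eq_of_subset_of_ncard_le h (by rw [hT3, rstar_ncard hn])
          (Set.toFinite _)).symm
      obtain ⟨e, he, heT⟩ := Set.not_subset.1 this
      exact ⟨e, by simpa [t] using ⟨he.1, he.2, heT⟩⟩
    · push Not at hS1
      have h1 := touch_card hn S hS hS1 (S.biUnion t ∪ T.toFinset) (by
        rintro e he ⟨v, hv, hve⟩
        by_cases heT : e ∈ T
        · simp [heT]
        · apply Finset.mem_union_left
          exact Finset.mem_biUnion.2 ⟨v, hv, by simpa [t] using ⟨he, hve, heT⟩⟩)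
      have h2 := Finset.card_union_le (S.biUnion t) T.toFinset
      rw [← Set.ncard_eq_toFinset_card', hT3] at h2
      omega
  obtain ⟨f, hf, hft⟩ := (Finset.all_card_le_biUnion_card_iff_exists_injective t).1 hall
  have hft' : ∀ v, f v ∈ (wheel n).edgeSet ∧ v ∈ f v ∧ f v ∉ T := by
    intro v
    simpa [t] using hft v
  apply hTI (Set.range f)
  · rintro _ ⟨v, rfl⟩
    exact ⟨hE ▸ (hft' v).1, (hft' v).2.2⟩
  · refine indep_of_injOn _ M hE hC _ ?_ (Function.invFun f) ?_ ?_
    · rintro _ ⟨v, rfl⟩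
      exact (hft' v).1
    · rintro _ ⟨v, rfl⟩
      rw [Function.leftInverse_invFun hf v]
      exact (hft' v).2.1
    · rintro _ ⟨v, rfl⟩ _ ⟨w, rfl⟩ h
      rw [Function.leftInverse_invFun hf v, Function.leftInverse_invFun hf w] at h
      rw [h]
  · rw [← Set.image_univ, Set.ncard_image_of_injective _ hf, Set.ncard_univ, Nat.card_eq_fintype_card,
      Fintype.card_option, ZMod.card]

theorem rstar_triad (hn : 4 ≤ n) (M : Matroid (Sym2 (Option (ZMod n))))
    (hE : M.E = (wheel n).edgeSet) (hC : ∀ C, MCirc M C ↔ IsBicycle (wheel n) C)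
    (i : ZMod n) : Triad M (rstar i) := by
  haveI : NeZero n := ⟨by omega⟩
  refine ⟨fun e he => hE ▸ he.1, rstar_ncard hn i, fun I hI hind hcard => ?_⟩
  set B : Set (Sym2 (Option (ZMod n))) := bE '' {i}ᶜ with hB
  have hBc : B.ncard = n - 1 := by
    rw [hB, Set.ncard_image_of_injective _ bE_inj, Set.ncard_compl, Set.ncard_singleton,
      Nat.card_eq_fintype_card, ZMod.card]
  have hBE : B ⊆ (wheel n).edgeSet := by
    rintro _ ⟨j, _, rfl⟩
    exact bE_mem hn j
  have hBi : M.Indep B := by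
    refine indep_of_injOn _ M hE hC _ hBE
      (fun e => some (Function.invFun bE e)) ?_ ?_
    · rintro _ ⟨j, _, rfl⟩
      simp only [Function.leftInverse_invFun bE_inj j]
      simp [bE]
    · rintro _ ⟨j, _, rfl⟩ _ ⟨k, _, rfl⟩ h
      simp only [Function.leftInverse_invFun bE_inj j, Function.leftInverse_invFun bE_inj k,
        Option.some.injEq] at h
      rw [h]
  have hlt : ∀ X Y : Set (Sym2 (Option (ZMod n))), X.ncard < Y.ncard → X.encard < Y.encard := by
    intro X Y h
    rw [← (Set.toFinite X).cast_ncard_eq, ← (Set.toFinite Y).cast_ncard_eq]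
    exact_mod_cast h
  obtain ⟨e, he, h1⟩ := hBi.augment hind (hlt _ _ (by omega))
  have hc1 : (insert e B).ncard = n := by
    rw [Set.ncard_insert_of_notMem he.2, hBc]; omega
  obtain ⟨e', he', h2⟩ := h1.augment hind (hlt _ _ (by omega))
  have hc2 : (insert e' (insert e B)).ncard = n + 1 := by
    rw [Set.ncard_insert_of_notMem he'.2, hc1]
  set D := insert e' (insert e B) with hD
  have hDE : D ⊆ (wheel n).edgeSet := hE ▸ h2.subset_ground
  have hBD : B ⊆ D := (Set.subset_insert _ _).trans (Set.subset_insert _ _)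
  have hDi : ∀ f ∈ D, some i ∉ f := by
    rintro f (rfl | rfl | ⟨j, hj, rfl⟩) h
    · exact (hI he'.1).2 ⟨hE ▸ (hI he'.1).1, h⟩
    · exact (hI he.1).2 ⟨hE ▸ (hI he.1).1, h⟩
    · simp only [bE, Sym2.mem_iff, reduceCtorEq, Option.some.injEq, false_or] at h
      exact hj h.symm
  have hsupp : edgeSupp D ⊆ {some i}ᶜ := by
    rintro v ⟨f, hf, hv⟩ rfl
    exact hDi f hf hv
  have hreach : ∀ u ∈ edgeSupp D, (SimpleGraph.fromEdgeSet D).Reachable none u := by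
    intro u hu
    cases u with
    | none => exact SimpleGraph.Reachable.refl _
    | some j =>
      apply SimpleGraph.Adj.reachable
      rw [SimpleGraph.fromEdgeSet_adj]
      refine ⟨hBD ⟨j, ?_, rfl⟩, by simp⟩
      intro h
      exact hsupp hu (by rw [Set.mem_singleton_iff] at h ⊢; rw [h])
  refine ((indep_iff_QQ _ M hE hC D).1 h2).2 D subset_rfl ⟨⟨⟨e', Set.mem_insert _ _⟩, ?_⟩, ?_⟩
  · intro u hu v hv
    exact (hreach u hu).symm.trans (hreach v hv)
  · have h3 := Set.ncard_le_ncard hsupp (Set.toFinite _)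
    rw [Set.ncard_compl, Set.ncard_singleton, Nat.card_eq_fintype_card, Fintype.card_option,
      ZMod.card] at h3
    omega

/-- dihedral action on the rim -/
def dAct : DihedralGroup n → ZMod n → ZMod n
  | .r i => fun x => x + i
  | .sr i => fun x => -x - i

theorem dAct_one (x : ZMod n) : dAct 1 x = x := by
  rw [DihedralGroup.one_def]; simp [dAct]

theorem dAct_mul (d d' : DihedralGroup n) (x : ZMod n) :
    dAct (d * d') x = dAct d (dAct d' x) := by
  rcases d with i | i <;> rcases d' with j | j <;> simp [dAct] <;> ring

theorem dAct_inj (d : DihedralGroup n) : Function.Injective (dAct d) := by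
  rcases d with i | i <;> intro x y h <;> simpa [dAct] using h

/-- dihedral action on vertices -/
def vAct (d : DihedralGroup n) : Option (ZMod n) → Option (ZMod n) := Option.map (dAct d)

theorem vAct_inj (d : DihedralGroup n) : Function.Injective (vAct d) :=
  Option.map_injective (dAct_inj d)

theorem map_bE (d : DihedralGroup n) (i : ZMod n) :
    Sym2.map (vAct d) (bE i) = bE (dAct d i) := by
  simp [bE, vAct]

theorem map_mem (hn : 4 ≤ n) (d : DihedralGroup n) (e : Sym2 (Option (ZMod n)))
    (he : e ∈ (wheel n).edgeSet) : Sym2.map (vAct d) e ∈ (wheel n).edgeSet := by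
  rcases (mem_wheel hn e).1 he with ⟨i, rfl⟩ | ⟨i, rfl⟩
  · rw [map_bE]; exact bE_mem hn _
  · rw [mem_wheel hn]
    right
    rcases d with j | j
    · refine ⟨i + j, ?_⟩
      simp only [aE, vAct, dAct, Sym2.map_mk, Option.map_some]
      rw [add_right_comm]
    · refine ⟨-(i + 1) - j, ?_⟩
      simp only [aE, vAct, dAct, Sym2.map_mk, Option.map_some]
      rw [Sym2.eq_swap]
      congr 3
      ring

theorem vAct_mul (d d' : DihedralGroup n) : vAct (d * d') = vAct d ∘ vAct d' := by
  funext v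
  cases v <;> simp [vAct, dAct_mul]

theorem vAct_one : vAct (1 : DihedralGroup n) = id := by
  funext v
  cases v <;> simp [vAct, dAct_one]

/-- action on edges, trivial off the wheel -/
noncomputable def eAct (d : DihedralGroup n) (e : Sym2 (Option (ZMod n))) :
    Sym2 (Option (ZMod n)) :=
  if e ∈ (wheel n).edgeSet then Sym2.map (vAct d) e else e

theorem eAct_one (e : Sym2 (Option (ZMod n))) : eAct 1 e = e := by
  simp [eAct, vAct_one]

theorem eAct_mul (hn : 4 ≤ n) (d d' : DihedralGroup n) (e : Sym2 (Option (ZMod n))) :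
    eAct (d * d') e = eAct d (eAct d' e) := by
  by_cases he : e ∈ (wheel n).edgeSet
  · have := map_mem hn d' e he
    simp only [eAct, he, this, if_true, vAct_mul, Sym2.map_map]
  · simp only [eAct, he, if_false]

/-- the permutation of the edges -/
noncomputable def ePerm (hn : 4 ≤ n) (d : DihedralGroup n) :
    Equiv.Perm (Sym2 (Option (ZMod n))) where
  toFun := eAct d
  invFun := eAct d⁻¹
  left_inv e := by rw [← eAct_mul hn, inv_mul_cancel, eAct_one]
  right_inv e := by rw [← eAct_mul hn, mul_inv_cancel, eAct_one]

theorem ePerm_indep (hn : 4 ≤ n) (M : Matroid (Sym2 (Option (ZMod n))))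
    (hE : M.E = (wheel n).edgeSet) (hC : ∀ C, MCirc M C ↔ IsBicycle (wheel n) C)
    (d : DihedralGroup n) (I : Set (Sym2 (Option (ZMod n)))) (hI : M.Indep I) :
    M.Indep (eAct d '' I) := by
  haveI : NeZero n := ⟨by omega⟩
  rw [indep_iff_QQ _ M hE hC] at hI ⊢
  have him : ∀ J ⊆ (wheel n).edgeSet, ∀ d : DihedralGroup n,
      eAct d '' J = Sym2.map (vAct d) '' J := by
    intro J hJ d
    apply Set.image_congr
    intro e he
    simp [eAct, hJ he]
  have h1 : eAct d '' I ⊆ (wheel n).edgeSet := by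
    rw [him I hI.1]
    rintro _ ⟨e, he, rfl⟩
    exact map_mem hn d e (hI.1 he)
  refine ⟨h1, fun D hD hQ => ?_⟩
  refine hI.2 (Sym2.map (vAct d⁻¹) '' D) ?_ (QQ_image _ (vAct_inj _) D hQ)
  rw [← him D (hD.trans h1)]
  rintro _ ⟨e, he, rfl⟩
  obtain ⟨f, hf, rfl⟩ := hD he
  rwa [← eAct_mul hn, inv_mul_cancel, eAct_one]

theorem ePerm_auto (hn : 4 ≤ n) (M : Matroid (Sym2 (Option (ZMod n))))
    (hE : M.E = (wheel n).edgeSet) (hC : ∀ C, MCirc M C ↔ IsBicycle (wheel n) C)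
    (d : DihedralGroup n) : IsMAuto M (ePerm hn d) := by
  refine ⟨fun x hx => ?_, fun I => ⟨fun h => ?_, ePerm_indep hn M hE hC d I⟩⟩
  · rw [hE] at hx
    simp [ePerm, eAct, hx]
  · have := ePerm_indep hn M hE hC d⁻¹ _ h
    rw [Set.image_image] at this
    simpa [ePerm, ← eAct_mul hn, eAct_one] using this

theorem cyc_rigid [NeZero n] (hn : 4 ≤ n) (p : ZMod n → ZMod n) (hp : Function.Injective p)
    (hadj : ∀ i, p (i + 1) = p i + 1 ∨ p i = p (i + 1) + 1) :
    ∃ d : DihedralGroup n, ∀ i, p i = dAct d i := by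
  have h2 := (zmod_ne hn).2
  have hne : ∀ i, p (i + 1 + 1) ≠ p i := by
    intro i h
    have := hp h
    apply h2
    have h3 : i + 2 = i := by rw [← one_add_one_eq_two, ← add_assoc, this]
    simpa using h3
  rcases hadj 0 with h0 | h0
  · refine ⟨.r (p 0), ?_⟩
    have key : ∀ k : ℕ, p ((k : ZMod n) + 1) = p k + 1 ∧ p k = p 0 + k := by
      intro k
      induction k with
      | zero => simpa using h0
      | succ k ih =>
        push_cast
        refine ⟨?_, by rw [ih.1, ih.2]; ring⟩
        rcases hadj ((k : ZMod n) + 1) with h | h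
        · exact h
        · exfalso
          apply hne k
          rw [ih.1] at h
          exact (add_right_cancel h).symm
    intro i
    have := (key i.val).2
    rw [ZMod.natCast_zmod_val] at this
    rw [this]; simp [dAct]; ring
  · refine ⟨.sr (- p 0), ?_⟩
    have key : ∀ k : ℕ, p k = p ((k : ZMod n) + 1) + 1 ∧ p k = p 0 - k := by
      intro k
      induction k with
      | zero => simpa using h0
      | succ k ih =>
        push_cast
        refine ⟨?_, by rw [eq_sub_of_add_eq ih.1.symm, ih.2]; ring⟩
        rcases hadj ((k : ZMod n) + 1) with h | h
        · exfalso
          apply hne k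
          rw [h, ← ih.1]
        · exact h
    intro i
    have := (key i.val).2
    rw [ZMod.natCast_zmod_val] at this
    rw [this]; simp [dAct]; ring

theorem auto_surj (hn : 4 ≤ n) (M : Matroid (Sym2 (Option (ZMod n))))
    (hE : M.E = (wheel n).edgeSet) (hC : ∀ C, MCirc M C ↔ IsBicycle (wheel n) C)
    (σ : Equiv.Perm (Sym2 (Option (ZMod n)))) (hσ : IsMAuto M σ) :
    ∃ d, ePerm hn d = σ := by
  haveI : NeZero n := ⟨by omega⟩
  have hσE : ∀ e, σ e ∈ M.E ↔ e ∈ M.E := by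
    intro e
    constructor
    · intro h
      by_contra h'
      rw [hσ.1 e h'] at h
      exact h' h
    · intro h
      by_contra h'
      have := σ.injective (hσ.1 _ h')
      rw [this] at h'
      exact h' h
  have htri : ∀ T, Triad M T → Triad M (σ '' T) := by
    rintro T ⟨h1, h2, h3⟩
    refine ⟨?_, by rw [Set.ncard_image_of_injective _ σ.injective, h2], ?_⟩
    · rintro _ ⟨e, he, rfl⟩
      exact (hσE e).2 (h1 he)
    · intro I hI hind
      have hIi : σ '' (σ ⁻¹' I) = I := Set.image_preimage_eq _ σ.surjective
      rw [← hIi, Set.ncard_image_of_injective _ σ.injective]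
      apply h3
      · intro e he
        refine ⟨(hσE e).1 (hI he).1, fun h => (hI he).2 ⟨e, h, rfl⟩⟩
      · rw [← hσ.2, hIi]
        exact hind
  have hex : ∀ i : ZMod n, ∃ j, σ '' rstar i = rstar j := fun i =>
    triad_is_rstar hn M hE hC _ (htri _ (rstar_triad hn M hE hC i))
  choose p hp using hex
  have hmem : ∀ i e, σ e ∈ rstar (p i) ↔ e ∈ rstar i := by
    intro i e
    rw [← hp, σ.injective.mem_set_image]
  have hbst : ∀ i j : ZMod n, bE i ∈ rstar j ↔ j = i := by
    intro i j
    constructor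
    · rintro ⟨_, h⟩
      simpa [bE] using h
    · rintro rfl
      exact ⟨bE_mem hn _, by simp [bE]⟩
  have hpinj : Function.Injective p := by
    intro i j h
    have h1 := (hmem i (bE i)).2 ((hbst i i).2 rfl)
    rw [h, hmem, hbst] at h1
    exact h1.symm
  have hpsurj : Function.Surjective p := Finite.surjective_of_injective hpinj
  have h10 := (zmod_ne hn).1
  have ha : ∀ i, σ (aE i) ∈ (wheel n).edgeSet ∧ σ (aE i) = s(some (p i), some (p (i + 1))) := by
    intro i
    have h1 := (hmem i (aE i)).2 ⟨aE_mem hn _, by simp [aE]⟩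
    have h2 := (hmem (i + 1) (aE i)).2 ⟨aE_mem hn _, by simp [aE]⟩
    refine ⟨h1.1, ?_⟩
    apply (Sym2.mem_and_mem_iff _).1 ⟨h1.2, h2.2⟩
    intro h
    have := hpinj (Option.some_injective _ h)
    simp [h10] at this
  have hadj : ∀ i, p (i + 1) = p i + 1 ∨ p i = p (i + 1) + 1 := by
    intro i
    obtain ⟨h1, h2⟩ := ha i
    rw [h2, mem_wheel hn] at h1
    rcases h1 with ⟨j, hj⟩ | ⟨j, hj⟩
    · simp [bE] at hj
    · simp only [aE, Sym2.eq_iff, Option.some.injEq] at hj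
      rcases hj with ⟨h, h'⟩ | ⟨h, h'⟩
      · left; rw [h, h']
      · right; rw [h, h']
  have hb : ∀ i, σ (bE i) = bE (p i) := by
    intro i
    have h1 := (hmem i (bE i)).2 ((hbst i i).2 rfl)
    rcases (mem_wheel hn _).1 h1.1 with ⟨j, hj⟩ | ⟨j, hj⟩
    · rw [hj, hbst] at h1
      rw [hj, h1]
    · exfalso
      have hq : ∀ k, some k ∈ σ (bE i) → k = p i := by
        intro k hk
        obtain ⟨l, rfl⟩ := hpsurj k
        have : σ (bE i) ∈ rstar (p l) := ⟨h1.1, hk⟩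
        rw [hmem, hbst] at this
        rw [this]
      have e1 := hq j (by rw [hj]; simp [aE])
      have e2 := hq (j + 1) (by rw [hj]; simp [aE])
      rw [← e1] at e2
      simp [h10] at e2
  obtain ⟨d, hd⟩ := cyc_rigid hn p hpinj hadj
  refine ⟨d, Equiv.ext fun e => ?_⟩
  change eAct d e = σ e
  by_cases he : e ∈ (wheel n).edgeSet
  · simp only [eAct, he, if_true]
    rcases (mem_wheel hn e).1 he with ⟨i, rfl⟩ | ⟨i, rfl⟩
    · rw [map_bE, hb, hd]
    · rw [(ha i).2, hd, hd]
      simp [aE, vAct]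
  · rw [hσ.1 e (hE ▸ he)]
    simp only [eAct, he, if_false]

end helpers

/-- For `n ≥ 4`, the automorphism group of the bicircular matroid of the wheel `W n`
is isomorphic to the dihedral group `D n`. -/
theorem stmt12 (n : ℕ) (hn : 4 ≤ n)
    (M : Matroid (Sym2 (Option (ZMod n))))
    (hE : M.E = (wheel n).edgeSet)
    (hC : ∀ C : Set (Sym2 (Option (ZMod n))), MCirc M C ↔ IsBicycle (wheel n) C) :
    Nonempty (matroidAutGroup M ≃* DihedralGroup n) := by
  have hmul : ∀ d d' : DihedralGroup n, ePerm hn (d * d') = ePerm hn d * ePerm hn d' := by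
    intro d d'
    exact Equiv.ext fun e => eAct_mul hn d d' e
  let φ : DihedralGroup n →* matroidAutGroup M := MonoidHom.mk'
    (fun d => ⟨ePerm hn d, ePerm_auto hn M hE hC d⟩)
    (fun d d' => Subtype.ext (hmul d d'))
  have hinj : Function.Injective φ := by
    rw [injective_iff_map_eq_one]
    intro d hd
    have h1 : ePerm hn d = 1 := congrArg Subtype.val hd
    have h2 : ∀ i : ZMod n, dAct d i = i := by
      intro i
      have h3 : eAct d (bE i) = bE i := congrArg (fun f => f (bE i)) h1
      rw [eAct, if_pos (bE_mem hn i), map_bE] at h3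
      exact bE_inj h3
    rcases d with i | i
    · have := h2 0
      simp only [dAct, zero_add] at this
      rw [this, DihedralGroup.one_def]
    · exfalso
      have h3 := h2 0
      have h4 := h2 1
      simp only [dAct, neg_zero, zero_sub, neg_eq_zero] at h3
      simp only [dAct, h3, sub_zero] at h4
      apply (zmod_ne hn).2
      rw [← one_add_one_eq_two]
      nth_rewrite 1 [← h4]
      simp
  have hsurj : Function.Surjective φ := by
    rintro ⟨σ, hσ⟩
    obtain ⟨d, hd⟩ := auto_surj hn M hE hC σ hσ
    exact ⟨d, Subtype.ext hd⟩
  exact ⟨(MulEquiv.ofBijective φ ⟨hinj, hsurj⟩).symm⟩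
end

section
/- If G is a 3-connected graph with at least 5 vertices, then the fixing number of the cycle matroid M(G) equals the fixing number of the bicircular matroid B(G). -/
/-- Three-connectivity: more than three vertices, and deleting any fewer than three
vertices leaves a connected graph. -/
def ThreeConnected {V : Type*} [Fintype V] (G : SimpleGraph V) : Prop :=
  4 ≤ Fintype.card V ∧
    ∀ S : Set V, S.ncard < 3 → ((⊤ : G.Subgraph).deleteVerts S).coe.Connected

section MatroidPart

variable {α : Type*}

lemma inj_image_ssubset {β : Type*} {f : α → β} (hf : Function.Injective f) {s t : Set α} :
    f '' s ⊂ f '' t ↔ s ⊂ t := by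
  rw [ssubset_iff_subset_not_subset, ssubset_iff_subset_not_subset,
    Set.image_subset_image_iff hf, Set.image_subset_image_iff hf]

lemma isMAuto_symm {M : Matroid α} {σ : Equiv.Perm α} (h : IsMAuto M σ) : IsMAuto M σ⁻¹ :=
  (matroidAutGroup M).inv_mem h

lemma perm_mem_iff {E : Set α} {σ : Equiv.Perm α} (h : ∀ x ∉ E, σ x = x) (x : α) :
    σ x ∈ E ↔ x ∈ E := by
  constructor
  · intro hx
    by_contra hn
    rw [h x hn] at hx
    exact hn hx
  · intro hx
    by_contra hn
    have := σ.injective (h _ hn)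
    rw [this] at hn
    exact hn hx

lemma perm_image_subset {E : Set α} {σ : Equiv.Perm α} (h : ∀ x ∉ E, σ x = x) (C : Set α) :
    σ '' C ⊆ E ↔ C ⊆ E := by
  rw [Set.image_subset_iff]
  constructor
  · intro hC x hx
    exact (perm_mem_iff h x).1 (hC hx)
  · intro hC x hx
    exact (perm_mem_iff h x).2 (hC hx)

lemma mcirc_image {M : Matroid α} {σ : Equiv.Perm α} (h : IsMAuto M σ) {C : Set α}
    (hC : MCirc M C) : MCirc M (σ '' C) := by
  obtain ⟨h1, h2, h3⟩ := hC
  refine ⟨(perm_image_subset h.1 C).2 h1, fun hI => h2 ((h.2 C).1 hI), fun D hD => ?_⟩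
  have hD' : D = σ '' (σ.symm '' D) := by simp [Set.image_image]
  rw [hD', h.2]
  apply h3
  rw [hD'] at hD
  exact (inj_image_ssubset σ.injective).1 hD

lemma indep_iff_circ [Finite α] (N : Matroid α) (I : Set α) :
    N.Indep I ↔ I ⊆ N.E ∧ ∀ C ⊆ I, ¬ MCirc N C := by
  constructor
  · intro h
    exact ⟨h.subset_ground, fun C hC hm => hm.2.1 (h.subset hC)⟩
  · rintro ⟨hE, h⟩
    by_contra hI
    obtain ⟨C, hCI, hC⟩ := exists_minimal_le_of_wellFoundedLT
      (fun C : Set α => ¬ N.Indep C) I hI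
    refine h C hCI ⟨hCI.trans hE, hC.prop, fun D hD => ?_⟩
    by_contra hDn
    exact hD.2 (hC.le_of_le hDn hD.1)

lemma isMAuto_of_circ [Finite α] {N : Matroid α} {σ : Equiv.Perm α}
    (h0 : ∀ x ∉ N.E, σ x = x) (h1 : ∀ C, MCirc N C → MCirc N (σ '' C))
    (h2 : ∀ C, MCirc N C → MCirc N (σ.symm '' C)) : IsMAuto N σ := by
  refine ⟨h0, fun I => ?_⟩
  rw [indep_iff_circ, indep_iff_circ, perm_image_subset h0]
  refine and_congr_right fun _ => ⟨fun h C hC hm => ?_, fun h C hC hm => ?_⟩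
  · exact h _ (Set.image_mono hC) (h1 C hm)
  · refine h _ ?_ (h2 C hm)
    rintro _ ⟨x, hx, rfl⟩
    obtain ⟨y, hy, rfl⟩ := hC hx
    simpa using hy

end MatroidPart

section GraphPart

variable {V : Type*}

/-- Edges avoiding the vertex `v`. -/
def delE (G : SimpleGraph V) (v : V) : Set (Sym2 V) := {e | e ∈ G.edgeSet ∧ v ∉ e}

/-- `σ` is induced by a graph automorphism. -/
def IsGA (G : SimpleGraph V) (σ : Equiv.Perm (Sym2 V)) : Prop :=
  (∀ x ∉ G.edgeSet, σ x = x) ∧ ∃ π : Equiv.Perm V, ∀ e ∈ G.edgeSet, σ e = Sym2.map π e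

lemma isGA_symm {G : SimpleGraph V} {σ : Equiv.Perm (Sym2 V)} (h : IsGA G σ) :
    IsGA G σ.symm := by
  obtain ⟨h0, π, hπ⟩ := h
  refine ⟨fun x hx => by rw [Equiv.symm_apply_eq, h0 x hx], π.symm, fun e he => ?_⟩
  have h' : σ.symm e ∈ G.edgeSet := by
    rw [← perm_mem_iff h0]; simpa using he
  have := hπ _ h'
  rw [Equiv.apply_symm_apply] at this
  conv_rhs => rw [this]
  rw [Sym2.map_map]; simp

lemma isGA_cycle {G : SimpleGraph V} {σ : Equiv.Perm (Sym2 V)} (h : IsGA G σ)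
    {C : Set (Sym2 V)} (hC : IsCycleSet G C) : IsCycleSet G (σ '' C) := by
  obtain ⟨h0, π, hπ⟩ := h
  obtain ⟨v, w, hw, rfl⟩ := hC
  let f : G →g G := ⟨π, by
    intro a b hab
    have h1 := hπ s(a, b) hab
    have h2 := (perm_mem_iff h0 s(a, b)).2 hab
    rw [h1] at h2
    simpa using h2⟩
  have hf : Function.Injective f := π.injective
  refine ⟨f v, w.map f, hw.map hf, ?_⟩
  ext e
  simp only [Set.mem_image, Set.mem_ofPred_eq, SimpleGraph.Walk.edges_map, List.mem_map]
  constructor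
  · rintro ⟨x, hx, rfl⟩
    exact ⟨x, hx, (hπ x (w.edges_subset_edgeSet hx)).symm⟩
  · rintro ⟨x, hx, rfl⟩
    exact ⟨x, hx, hπ x (w.edges_subset_edgeSet hx)⟩

lemma edgeSupp_map (π : Equiv.Perm V) (C : Set (Sym2 V)) :
    edgeSupp (Sym2.map π '' C) = π '' edgeSupp C := by
  ext v
  simp only [edgeSupp, Set.mem_ofPred_eq, Set.mem_image]
  constructor
  · rintro ⟨_, ⟨e, he, rfl⟩, hv⟩
    obtain ⟨x, hx, rfl⟩ := Sym2.mem_map.1 hv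
    exact ⟨x, ⟨e, he, hx⟩, rfl⟩
  · rintro ⟨x, ⟨e, he, hx⟩, rfl⟩
    exact ⟨_, ⟨e, he, rfl⟩, Sym2.mem_map.2 ⟨x, hx, rfl⟩⟩

lemma edgeConn_map (π : Equiv.Perm V) {C : Set (Sym2 V)} (h : EdgeConn C) :
    EdgeConn (Sym2.map π '' C) := by
  refine ⟨h.1.image _, ?_⟩
  rw [edgeSupp_map]
  rintro _ ⟨u, hu, rfl⟩ _ ⟨v, hv, rfl⟩
  let f : SimpleGraph.fromEdgeSet C →g SimpleGraph.fromEdgeSet (Sym2.map π '' C) := ⟨π, by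
    intro a b hab
    rw [SimpleGraph.fromEdgeSet_adj] at hab ⊢
    exact ⟨⟨_, hab.1, by simp⟩, fun hh => hab.2 (π.injective hh)⟩⟩
  exact (h.2 u hu v hv).map f

lemma bic_map (π : Equiv.Perm V) {C : Set (Sym2 V)}
    (h : EdgeConn C ∧ C.Finite ∧ (edgeSupp C).ncard < C.ncard) :
    EdgeConn (Sym2.map π '' C) ∧ (Sym2.map π '' C).Finite ∧
      (edgeSupp (Sym2.map π '' C)).ncard < (Sym2.map π '' C).ncard := by
  refine ⟨edgeConn_map π h.1, h.2.1.image _, ?_⟩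
  rw [edgeSupp_map, Set.ncard_image_of_injective _ π.injective,
    Set.ncard_image_of_injective _ (Sym2.map.injective π.injective)]
  exact h.2.2

lemma isGA_bicycle {G : SimpleGraph V} {σ : Equiv.Perm (Sym2 V)} (h : IsGA G σ)
    {C : Set (Sym2 V)} (hC : IsBicycle G C) : IsBicycle G (σ '' C) := by
  obtain ⟨h0, π, hπ⟩ := h
  obtain ⟨c1, c2, c3, c4, c5⟩ := hC
  have himg : σ '' C = Sym2.map π '' C :=
    Set.image_congr fun e he => hπ e (c1 he)
  have hb := bic_map π ⟨c3, c2, c4⟩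
  refine ⟨(perm_image_subset h0 C).2 c1, ?_⟩
  rw [himg]
  refine ⟨hb.2.1, hb.1, hb.2.2, fun D hD hDb => ?_⟩
  have hD2 := bic_map π.symm hDb
  refine c5 _ ?_ hD2
  have : C = Sym2.map π.symm '' (Sym2.map π '' C) := by
    rw [Set.image_image]; simp [Sym2.map_map]
  rw [this]
  exact (inj_image_ssubset (Sym2.map.injective π.symm.injective)).2 hD

lemma isGA_auto [Finite V] {G : SimpleGraph V} {σ : Equiv.Perm (Sym2 V)} (h : IsGA G σ)
    (N : Matroid (Sym2 V)) (hE : N.E = G.edgeSet)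
    (hN : (∀ C, MCirc N C ↔ IsCycleSet G C) ∨ (∀ C, MCirc N C ↔ IsBicycle G C)) :
    IsMAuto N σ := by
  refine isMAuto_of_circ (by rw [hE]; exact h.1) ?_ ?_
  · rcases hN with hN | hN <;> intro C hC <;> rw [hN] at hC ⊢
    · exact isGA_cycle h hC
    · exact isGA_bicycle h hC
  · rcases hN with hN | hN <;> intro C hC <;> rw [hN] at hC ⊢
    · exact isGA_cycle (isGA_symm h) hC
    · exact isGA_bicycle (isGA_symm h) hC

lemma isGA_of_stars [Finite V] {G : SimpleGraph V} {σ : Equiv.Perm (Sym2 V)} (P : Set V)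
    (hbad : ∀ a ∉ P, ∀ b ∉ P, a = b)
    (hsep : ∀ v w, v ≠ w → ∃ e ∈ G.edgeSet, v ∈ e ∧ w ∉ e)
    (h0 : ∀ x ∉ G.edgeSet, σ x = x)
    (hσ : ∀ v ∈ P, ∃ w ∈ P, σ '' delE G v = delE G w) : IsGA G σ := by
  classical
  have key : ∀ v, ∃ w, v ∈ P → (w ∈ P ∧ ∀ e ∈ G.edgeSet, (w ∈ σ e ↔ v ∈ e)) := by
    intro v
    by_cases hv : v ∈ P
    · obtain ⟨w, hw, h⟩ := hσ v hv
      refine ⟨w, fun _ => ⟨hw, fun e he => ?_⟩⟩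
      have h1 : σ e ∈ delE G w ↔ e ∈ delE G v := by
        rw [← h]; exact σ.injective.mem_set_image
      have h2 : σ e ∈ G.edgeSet := (perm_mem_iff h0 e).2 he
      simp only [delE, Set.mem_ofPred_eq, h2, he, true_and] at h1
      exact not_iff_not.1 h1
    · exact ⟨v, fun h => absurd h hv⟩
  choose p hp using key
  let q : V → V := fun v => if v ∈ P then p v else v
  have q1 : ∀ v ∈ P, q v = p v := fun v hv => if_pos hv
  have q2 : ∀ v ∉ P, q v = v := fun v hv => if_neg hv
  have qP : ∀ v, q v ∈ P ↔ v ∈ P := by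
    intro v
    by_cases hv : v ∈ P
    · rw [q1 v hv]; exact ⟨fun _ => hv, fun _ => (hp v hv).1⟩
    · rw [q2 v hv]
  have qinj : Function.Injective q := by
    intro a b hab
    have hab' : a ∈ P ↔ b ∈ P := by rw [← qP a, ← qP b, hab]
    by_cases ha : a ∈ P
    · have hb := hab'.1 ha
      by_contra hne
      obtain ⟨e, he, hae, hbe⟩ := hsep a b hne
      rw [q1 a ha, q1 b hb] at hab
      have h1 := ((hp a ha).2 e he).2 hae
      rw [hab] at h1
      exact hbe (((hp b hb).2 e he).1 h1)
    · exact hbad a ha b (fun hb => ha (hab'.2 hb))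
  have qbij : Function.Bijective q := Finite.injective_iff_bijective.1 qinj
  have main : ∀ e ∈ G.edgeSet, ∀ a ∈ e, q a ∈ σ e := by
    intro e he a hae
    by_cases ha : a ∈ P
    · rw [q1 a ha]; exact ((hp a ha).2 e he).2 hae
    · obtain ⟨b, rfl⟩ := Sym2.mem_iff_exists.1 hae
      have hne : a ≠ b := G.ne_of_adj he
      have hb : b ∈ P := by
        by_contra hb; exact hne (hbad a ha b hb)
      have hbe : q b ∈ σ s(a, b) := by
        rw [q1 b hb]; exact ((hp b hb).2 _ he).2 (by simp)
      obtain ⟨x, hx⟩ := Sym2.mem_iff_exists.1 hbe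
      have hσe := (perm_mem_iff h0 _).2 he
      rw [hx] at hσe
      have hxb : q b ≠ x := G.ne_of_adj hσe
      have hxP : x ∉ P := by
        intro hxP
        obtain ⟨y, rfl⟩ := qbij.2 x
        have hy : y ∈ P := (qP y).1 hxP
        have h2 := ((hp y hy).2 _ he).1 (by rw [hx, ← q1 y hy]; simp)
        rcases Sym2.mem_iff.1 h2 with rfl | rfl
        · exact ha hy
        · exact hxb rfl
      rw [q2 a ha, hx, hbad a ha x hxP]
      simp
  refine ⟨h0, Equiv.ofBijective q qbij, fun e he => ?_⟩
  induction e with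
  | _ a b =>
    have hne : a ≠ b := G.ne_of_adj he
    have ha := main _ he a (by simp)
    have hb := main _ he b (by simp)
    simpa using ((Sym2.mem_and_mem_iff (fun h => hne (qinj h))).1 ⟨ha, hb⟩)

lemma isGA_of_family [Finite V] {G : SimpleGraph V} {N : Matroid (Sym2 V)}
    (hE : N.E = G.edgeSet) (P : Set V) (Fam : Set (Sym2 V) → Prop)
    (hbad : ∀ a ∉ P, ∀ b ∉ P, a = b)
    (hsep : ∀ v w, v ≠ w → ∃ e ∈ G.edgeSet, v ∈ e ∧ w ∉ e)
    (hA : ∀ v ∈ P, Fam (delE G v))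
    (hB : ∀ F, Fam F → ∃ v ∈ P, F ⊆ delE G v)
    (hinv : ∀ τ, IsMAuto N τ → ∀ F, Fam F → Fam (τ '' F))
    {σ : Equiv.Perm (Sym2 V)} (hσ : IsMAuto N σ) : IsGA G σ := by
  have hC : ∀ v w, delE G v ⊆ delE G w → v = w := by
    intro v w h
    by_contra hne
    obtain ⟨e, he, h1, h2⟩ := hsep w v (Ne.symm hne)
    exact (h ⟨he, h2⟩).2 h1
  refine isGA_of_stars P hbad hsep (by rw [← hE]; exact hσ.1) fun v hv => ?_
  obtain ⟨w, hw, h1⟩ := hB _ (hinv σ hσ _ (hA v hv))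
  obtain ⟨u, hu, h2⟩ := hB _ (hinv _ (isMAuto_symm hσ) _ (hA w hw))
  have h3 : delE G v ⊆ (σ⁻¹ : Equiv.Perm (Sym2 V)) '' delE G w := by
    intro e he
    exact ⟨σ e, h1 ⟨e, he, rfl⟩, by simp⟩
  have huv := hC v u (h3.trans h2)
  subst huv
  refine ⟨w, hw, h1.antisymm fun e he => ?_⟩
  exact ⟨σ⁻¹ e, h2 ⟨e, he, rfl⟩, by simp⟩

/-- Usable form of 3-connectivity. -/
def Conn3 (G : SimpleGraph V) : Prop :=
  ∀ s t a b : V, a ≠ s → a ≠ t → b ≠ s → b ≠ t →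
    ∃ p : G.Walk a b, p.IsPath ∧ s ∉ p.support ∧ t ∉ p.support

lemma conn3_of [Fintype V] {G : SimpleGraph V} (h : ThreeConnected G) : Conn3 G := by
  classical
  intro s t a b has hat hbs hbt
  have hc := h.2 {s, t} (by
    have := Set.ncard_insert_le s {t}
    rw [Set.ncard_singleton] at this; omega)
  have ha : a ∈ ((⊤ : G.Subgraph).deleteVerts {s, t}).verts := by simp [has, hat]
  have hb : b ∈ ((⊤ : G.Subgraph).deleteVerts {s, t}).verts := by simp [hbs, hbt]
  obtain ⟨w⟩ := hc.preconnected ⟨a, ha⟩ ⟨b, hb⟩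
  let w' : G.Walk a b := w.map (SimpleGraph.Subgraph.hom _)
  have hw' : ∀ x ∈ w'.support, x ≠ s ∧ x ≠ t := by
    intro x hx
    have hx' : x ∈ w.support.map (SimpleGraph.Subgraph.hom _) := by
      rw [← SimpleGraph.Walk.support_map]; exact hx
    obtain ⟨y, _, rfl⟩ := List.mem_map.1 hx'
    have := y.2
    simpa using this
  refine ⟨w'.bypass, w'.bypass_isPath, fun hs => ?_, fun ht => ?_⟩
  · exact (hw' s (w'.support_bypass_subset_support hs)).1 rfl
  · exact (hw' t (w'.support_bypass_subset_support ht)).2 rfl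

/-- every vertex has a neighbour outside any prescribed pair -/
lemma exists_nbr [Fintype V] {G : SimpleGraph V} (h : Conn3 G) (hV : 5 ≤ Fintype.card V)
    (x s t : V) (hs : x ≠ s) (ht : x ≠ t) : ∃ y, G.Adj x y ∧ y ≠ s ∧ y ≠ t := by
  classical
  have : ∃ z, z ∉ ({x, s, t} : Finset V) := by
    by_contra hcon
    push Not at hcon
    have h1 : (Finset.univ : Finset V) ⊆ {x, s, t} := fun z _ => hcon z
    have h2 := Finset.card_le_card h1
    have h3 := Finset.card_le_three (a := x) (b := s) (c := t)
    rw [Finset.card_univ] at h2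
    omega
  obtain ⟨z, hz⟩ := this
  simp only [Finset.mem_insert, Finset.mem_singleton, not_or] at hz
  obtain ⟨p, hp, h1, h2⟩ := h s t x z hs ht hz.2.1 hz.2.2
  cases p with
  | nil => exact absurd rfl hz.1
  | cons hadj q =>
    rename_i y
    refine ⟨y, hadj, ?_, ?_⟩
    · rintro rfl; exact h1 (by simp)
    · rintro rfl; exact h2 (by simp)

lemma sep_of [Fintype V] {G : SimpleGraph V} (h : Conn3 G) (hV : 5 ≤ Fintype.card V)
    (v w : V) (hvw : v ≠ w) : ∃ e ∈ G.edgeSet, v ∈ e ∧ w ∉ e := by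
  obtain ⟨y, hy, h1, -⟩ := exists_nbr h hV v w w hvw hvw
  exact ⟨s(v, y), hy, by simp, by simp [hvw.symm, h1.symm]⟩

/-- proper connected flats, expressed through circuits -/
def FamM (N : Matroid (Sym2 V)) (F : Set (Sym2 V)) : Prop :=
  F ⊆ N.E ∧ F ≠ N.E ∧ (∀ C, MCirc N C → ∀ e ∈ C, C \ {e} ⊆ F → e ∈ F) ∧
    ∀ e ∈ F, ∀ f ∈ F, Relation.ReflTransGen
      (fun a b => ∃ C, MCirc N C ∧ C ⊆ F ∧ a ∈ C ∧ b ∈ C) e f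

lemma famM_inv {N : Matroid (Sym2 V)} {τ : Equiv.Perm (Sym2 V)} (h : IsMAuto N τ)
    (F : Set (Sym2 V)) (hF : FamM N F) : FamM N (τ '' F) := by
  obtain ⟨h1, h2, h3, h4⟩ := hF
  refine ⟨(perm_image_subset h.1 F).2 h1, fun hh => h2 (h1.antisymm fun x hx => ?_), ?_, ?_⟩
  · have := (perm_mem_iff h.1 x).2 hx
    rw [← hh] at this
    exact τ.injective.mem_set_image.1 this
  · intro C hC e he hCe
    have hC' := mcirc_image (isMAuto_symm h) hC
    refine ⟨τ⁻¹ e, h3 _ hC' _ ⟨e, he, rfl⟩ ?_, by simp⟩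
    rintro _ ⟨⟨x, hx, rfl⟩, hne⟩
    have : x ∈ C \ {e} := ⟨hx, fun hxe => hne (by rw [hxe]; rfl)⟩
    obtain ⟨y, hy, rfl⟩ := hCe this
    simpa using hy
  · rintro _ ⟨e, he, rfl⟩ _ ⟨f, hf, rfl⟩
    refine (h4 e he f hf).lift τ ?_
    rintro a b ⟨C, hC, hCF, ha, hb⟩
    exact ⟨τ '' C, mcirc_image h hC, Set.image_mono hCF, ⟨a, ha, rfl⟩, ⟨b, hb, rfl⟩⟩

lemma cyc_two {G : SimpleGraph V} {C : Set (Sym2 V)} (hC : IsCycleSet G C) {v : V}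
    {e : Sym2 V} (he : e ∈ C) (hv : v ∈ e) : ∃ e' ∈ C, e' ≠ e ∧ v ∈ e' := by
  classical
  obtain ⟨u, w, hw, rfl⟩ := hC
  obtain ⟨x, rfl⟩ := Sym2.mem_iff_exists.1 hv
  have hvs : v ∈ w.support := SimpleGraph.Walk.fst_mem_support_of_mem_edges w he
  have hc := hw.rotate hvs
  have hr : ∀ f, f ∈ (w.rotate v hvs).edges ↔ f ∈ w.edges := fun f =>
    (SimpleGraph.Walk.rotate_edges w v hvs).mem_iff
  generalize w.rotate v hvs = c at hc hr
  cases c with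
  | nil => exact absurd rfl hc.ne_nil
  | cons h p =>
    rename_i b
    rw [SimpleGraph.Walk.cons_isCycle_iff] at hc
    have hnil : ¬ p.Nil := fun hn => h.ne hn.eq.symm
    have hlast : s(p.penultimate, v) ∈ p.edges := SimpleGraph.Walk.mk_penultimate_end_mem_edges hnil
    by_cases hx : s(v, x) = s(v, b)
    · refine ⟨s(p.penultimate, v), (hr _).1 (by simp [hlast]), ?_, by simp⟩
      rw [hx]
      intro hh
      rw [hh] at hlast
      exact hc.2 hlast
    · exact ⟨s(v, b), (hr _).1 (by simp), fun hh => hx hh.symm, by simp⟩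

lemma common_cycle {G : SimpleGraph V} (h : Conn3 G) {v a b c : V} (hba : G.Adj b a)
    (hbc : G.Adj b c) (hac : a ≠ c) (hva : v ≠ a) (hvb : v ≠ b) (hvc : v ≠ c) :
    ∃ C, IsCycleSet G C ∧ C ⊆ delE G v ∧ s(b, a) ∈ C ∧ s(b, c) ∈ C := by
  obtain ⟨p, hp, h1, h2⟩ := h v b a c hva.symm hba.ne.symm hvc.symm hbc.ne.symm
  have hb : ∀ x, s(b, x) ∉ p.edges := fun x hx =>
    h2 (SimpleGraph.Walk.fst_mem_support_of_mem_edges p hx)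
  refine ⟨_, ⟨b, SimpleGraph.Walk.cons hba (p.concat hbc.symm), ?_, rfl⟩, ?_, ?_, ?_⟩
  · rw [SimpleGraph.Walk.cons_isCycle_iff]
    refine ⟨hp.concat h2 _, ?_⟩
    rw [SimpleGraph.Walk.edges_concat]
    simp only [List.concat_eq_append, List.mem_append, List.mem_singleton, not_or]
    refine ⟨hb a, ?_⟩
    rw [Sym2.eq_swap, Sym2.congr_left]
    exact hac
  · intro e he
    refine ⟨SimpleGraph.Walk.edges_subset_edgeSet _ he, ?_⟩
    simp only [SimpleGraph.Walk.edges_cons, SimpleGraph.Walk.edges_concat,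
      List.concat_eq_append, Set.mem_ofPred_eq, List.mem_cons, List.mem_append,
      List.not_mem_nil, or_false] at he
    rcases he with rfl | he | rfl
    · simp [hva, hvb]
    · intro hve
      obtain ⟨y, rfl⟩ := Sym2.mem_iff_exists.1 hve
      exact h1 (SimpleGraph.Walk.fst_mem_support_of_mem_edges p he)
    · simp [hvc, hvb]
  · simp
  · simp [SimpleGraph.Walk.edges_concat, Sym2.eq_swap]

lemma famM_delE [Fintype V] {G : SimpleGraph V} (h : Conn3 G) (hV : 5 ≤ Fintype.card V)
    {M : Matroid (Sym2 V)} (hME : M.E = G.edgeSet)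
    (hMC : ∀ C : Set (Sym2 V), MCirc M C ↔ IsCycleSet G C) (v : V) : FamM M (delE G v) := by
  refine ⟨by rw [hME]; exact fun e he => he.1, ?_, ?_, ?_⟩
  · intro hh
    have : ∃ w, w ≠ v := by
      have : Nontrivial V := Fintype.one_lt_card_iff_nontrivial.1 (by omega)
      exact exists_ne v
    obtain ⟨w, hw⟩ := this
    obtain ⟨e, he, hve, -⟩ := sep_of h hV v w hw.symm
    rw [← hME, ← hh] at he
    exact he.2 hve
  · intro C hC e he hCe
    refine ⟨by rw [← hME]; exact hC.1 he, fun hve => ?_⟩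
    obtain ⟨e', he', hne, hv'⟩ := cyc_two ((hMC C).1 hC) he hve
    exact (hCe ⟨he', hne⟩).2 hv'
  · have base : ∀ a : V, ∀ e ∈ delE G v, ∀ f ∈ delE G v, a ∈ e → a ∈ f →
        Relation.ReflTransGen
          (fun a b => ∃ C, MCirc M C ∧ C ⊆ delE G v ∧ a ∈ C ∧ b ∈ C) e f := by
      intro a e he f hf hae haf
      obtain ⟨x, rfl⟩ := Sym2.mem_iff_exists.1 hae
      obtain ⟨y, rfl⟩ := Sym2.mem_iff_exists.1 haf
      by_cases hxy : x = y
      · subst hxy; exact .refl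
      · have h1 := he.2
        have h2 := hf.2
        simp only [Sym2.mem_iff, not_or] at h1 h2
        obtain ⟨C, hC, c1, c2, c3⟩ := common_cycle h he.1 hf.1 hxy h1.2 h1.1 h2.2
        exact .single ⟨C, (hMC C).2 hC, c1, c2, c3⟩
    have walk : ∀ (a b : V) (p : G.Walk a b), v ∉ p.support → ∀ e ∈ delE G v,
        ∀ f ∈ delE G v, a ∈ e → b ∈ f → Relation.ReflTransGen
          (fun a b => ∃ C, MCirc M C ∧ C ⊆ delE G v ∧ a ∈ C ∧ b ∈ C) e f := by
      intro a b p
      induction p with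
      | nil => intro _ e he f hf hae haf; exact base _ e he f hf hae haf
      | cons hadj q ih =>
        rename_i a a' b
        intro hs e he f hf hae haf
        simp only [SimpleGraph.Walk.support_cons, List.mem_cons, not_or] at hs
        have hm : s(a, a') ∈ delE G v := by
          refine ⟨hadj, ?_⟩
          simp only [Sym2.mem_iff, not_or]
          refine ⟨hs.1, ?_⟩
          rintro rfl
          exact hs.2 q.start_mem_support
        exact (base a e he _ hm hae (by simp)).trans (ih hs.2 _ hm f hf (by simp) haf)
    intro e he f hf
    induction e with
    | _ a x =>
    induction f with
    | _ b y =>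
    have h1 := he.2
    have h2 := hf.2
    simp only [Sym2.mem_iff, not_or] at h1 h2
    obtain ⟨p, -, hp, -⟩ := h v v a b (Ne.symm h1.1) (Ne.symm h1.1) (Ne.symm h2.1) (Ne.symm h2.1)
    exact walk a b p hp _ he _ hf (by simp) (by simp)

lemma reach_cycle {G : SimpleGraph V} {C F : Set (Sym2 V)} (hC : IsCycleSet G C) (hCF : C ⊆ F)
    {e f : Sym2 V} (he : e ∈ C) (hf : f ∈ C) {a b : V} (ha : a ∈ e) (hb : b ∈ f) :
    (SimpleGraph.fromEdgeSet F).Reachable a b := by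
  classical
  obtain ⟨u, w, hw, rfl⟩ := hC
  obtain ⟨x, rfl⟩ := Sym2.mem_iff_exists.1 ha
  obtain ⟨y, rfl⟩ := Sym2.mem_iff_exists.1 hb
  have hw' : ∀ e ∈ w.edges, e ∈ (SimpleGraph.fromEdgeSet F).edgeSet := by
    intro e he
    rw [SimpleGraph.edgeSet_fromEdgeSet]
    exact ⟨hCF he, G.not_isDiag_of_mem_edgeSet (w.edges_subset_edgeSet he)⟩
  have hs : ∀ z ∈ w.support, (SimpleGraph.fromEdgeSet F).Reachable u z := by
    intro z hz
    have h1 := w.takeUntil z hz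
    refine ⟨(w.takeUntil z hz).transfer _ fun e he => hw' e ?_⟩
    exact SimpleGraph.Walk.edges_takeUntil_subset_edges w hz he
  exact (hs a (SimpleGraph.Walk.fst_mem_support_of_mem_edges w he)).symm.trans
    (hs b (SimpleGraph.Walk.fst_mem_support_of_mem_edges w hf))

lemma famM_sub {G : SimpleGraph V}
    {M : Matroid (Sym2 V)} (hME : M.E = G.edgeSet)
    (hMC : ∀ C : Set (Sym2 V), MCirc M C ↔ IsCycleSet G C) (F : Set (Sym2 V))
    (hF : FamM M F) : ∃ v, F ⊆ delE G v := by
  classical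
  obtain ⟨h1, h2, h3, h4⟩ := hF
  by_contra hcon
  push Not at hcon
  have hsupp : ∀ v, ∃ e ∈ F, v ∈ e := by
    intro v
    by_contra hn
    push Not at hn
    exact hcon v fun e he => ⟨by rw [← hME]; exact h1 he, hn e he⟩
  have hreach : ∀ a b, (SimpleGraph.fromEdgeSet F).Reachable a b := by
    intro a b
    obtain ⟨e, he, hae⟩ := hsupp a
    obtain ⟨f, hf, hbf⟩ := hsupp b
    have hrel := h4 e he f hf
    have hself : ∀ e ∈ F, ∀ a ∈ e, ∀ b ∈ e, (SimpleGraph.fromEdgeSet F).Reachable a b := by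
      intro e he a ha b hb
      by_cases hab : a = b
      · subst hab; exact .refl _
      · have : e = s(a, b) := (Sym2.mem_and_mem_iff hab).1 ⟨ha, hb⟩
        subst this
        exact SimpleGraph.Adj.reachable (by rw [SimpleGraph.fromEdgeSet_adj]; exact ⟨he, hab⟩)
    clear hf
    induction hrel generalizing b with
    | refl => exact hself e he a hae b hbf
    | tail _ hC ih =>
      rename_i g f _
      obtain ⟨C, hC, hCF, hg, hf⟩ := hC
      induction g with
      | _ x y =>
      exact (ih x (by simp)).trans (reach_cycle ((hMC C).1 hC) hCF hg hf (by simp) hbf)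
  apply h2
  refine h1.antisymm fun e he => ?_
  by_contra hne
  induction e with
  | _ a b =>
  have hadj : G.Adj a b := by rw [hME] at he; exact he
  obtain ⟨p, hp⟩ := (hreach b a).exists_isPath
  have hpF : ∀ e ∈ p.edges, e ∈ F := by
    intro e he
    have := p.edges_subset_edgeSet he
    rw [SimpleGraph.edgeSet_fromEdgeSet] at this
    exact this.1
  have hpG : ∀ e ∈ p.edges, e ∈ G.edgeSet := fun e he => by rw [← hME]; exact h1 (hpF e he)
  let q := p.transfer G hpG
  have hq : (SimpleGraph.Walk.cons hadj q).IsCycle := by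
    rw [SimpleGraph.Walk.cons_isCycle_iff]
    refine ⟨hp.transfer hpG, fun hh => ?_⟩
    rw [SimpleGraph.Walk.edges_transfer] at hh
    exact hne (hpF _ hh)
  refine hne (h3 _ ((hMC _).2 ⟨a, _, hq, rfl⟩) s(a, b) (by simp) ?_)
  rintro f ⟨hf, hfe⟩
  simp only [SimpleGraph.Walk.edges_cons, List.mem_cons, Set.mem_ofPred_eq, q,
    SimpleGraph.Walk.edges_transfer] at hf
  rcases hf with rfl | hf
  · exact absurd rfl hfe
  · exact hpF f hf

lemma isGA_of_M [Fintype V] {G : SimpleGraph V} (h : Conn3 G) (hV : 5 ≤ Fintype.card V)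
    {M : Matroid (Sym2 V)} (hME : M.E = G.edgeSet)
    (hMC : ∀ C : Set (Sym2 V), MCirc M C ↔ IsCycleSet G C)
    {σ : Equiv.Perm (Sym2 V)} (hσ : IsMAuto M σ) : IsGA G σ := by
  refine isGA_of_family hME Set.univ (FamM M) (fun a ha => absurd trivial ha) (sep_of h hV)
    (fun v _ => famM_delE h hV hME hMC v) (fun F hF => ?_) (fun τ hτ F hF => famM_inv hτ F hF) hσ
  obtain ⟨v, hv⟩ := famM_sub hME hMC F hF
  exact ⟨v, trivial, hv⟩

/-- coloop-free non-spanning sets -/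
def FamB (N : Matroid (Sym2 V)) (n : ℕ) (F : Set (Sym2 V)) : Prop :=
  F ⊆ N.E ∧ (∀ e ∈ F, ∃ C, MCirc N C ∧ C ⊆ F ∧ e ∈ C) ∧ ∀ I ⊆ F, N.Indep I → I.ncard < n

lemma famB_inv {N : Matroid (Sym2 V)} {n : ℕ} {τ : Equiv.Perm (Sym2 V)} (h : IsMAuto N τ)
    (F : Set (Sym2 V)) (hF : FamB N n F) : FamB N n (τ '' F) := by
  obtain ⟨h1, h2, h3⟩ := hF
  refine ⟨(perm_image_subset h.1 F).2 h1, ?_, ?_⟩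
  · rintro _ ⟨e, he, rfl⟩
    obtain ⟨C, hC, hCF, heC⟩ := h2 e he
    exact ⟨τ '' C, mcirc_image h hC, Set.image_mono hCF, ⟨e, heC, rfl⟩⟩
  · intro I hI hind
    have hI' : I = τ '' (τ.symm '' I) := by simp [Set.image_image]
    rw [hI', h.2] at hind
    rw [hI', Set.ncard_image_of_injective _ τ.injective]
    refine h3 _ ?_ hind
    rintro _ ⟨x, hx, rfl⟩
    obtain ⟨y, hy, rfl⟩ := hI hx
    simpa using hy

lemma edgeSupp_mono {C D : Set (Sym2 V)} (h : C ⊆ D) : edgeSupp C ⊆ edgeSupp D := by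
  rintro v ⟨e, he, hv⟩
  exact ⟨e, h he, hv⟩

lemma exists_conn [Finite V] {D : Set (Sym2 V)} (hD : (edgeSupp D).ncard < D.ncard) :
    ∃ C ⊆ D, EdgeConn C ∧ (edgeSupp C).ncard < C.ncard := by
  obtain ⟨C, hCD, hC⟩ := exists_minimal_le_of_wellFoundedLT
    (fun C : Set (Sym2 V) => (edgeSupp C).ncard < C.ncard) D hD
  have hCc : (edgeSupp C).ncard < C.ncard := hC.prop
  refine ⟨C, hCD, ⟨?_, ?_⟩, hCc⟩
  · exact (Set.ncard_pos (Set.toFinite _)).1 (by omega)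
  · intro u hu v hv
    by_contra hnr
    let R : V → Prop := fun x => (SimpleGraph.fromEdgeSet C).Reachable u x
    have hR : ∀ e ∈ C, ∀ x ∈ e, ∀ y ∈ e, R x → R y := by
      intro e he x hx y hy hRx
      by_cases hxy : x = y
      · exact hxy ▸ hRx
      · have : e = s(x, y) := (Sym2.mem_and_mem_iff hxy).1 ⟨hx, hy⟩
        subst this
        exact hRx.trans
          (SimpleGraph.Adj.reachable (by rw [SimpleGraph.fromEdgeSet_adj]; exact ⟨he, hxy⟩))
    let D1 : Set (Sym2 V) := {e | e ∈ C ∧ ∃ x ∈ e, R x}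
    have hD1 : D1 ⊆ C := fun e he => he.1
    have hD2 : C \ D1 ⊆ C := Set.diff_subset
    have hsmall : ∀ X ⊆ C, X ≠ C → X.ncard ≤ (edgeSupp X).ncard := by
      intro X hX hne
      by_contra hlt
      push Not at hlt
      exact hne (hX.antisymm (hC.le_of_le hlt hX))
    obtain ⟨eu, heu, hueu⟩ := hu
    obtain ⟨ev, hev, hvev⟩ := hv
    have heuD : eu ∈ D1 := ⟨heu, u, hueu, .refl _⟩
    have hevD : ev ∉ D1 := by
      rintro ⟨_, x, hx, hRx⟩
      exact hnr (hR ev hev x hx v hvev hRx)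
    have h1 := hsmall D1 hD1 (fun hh => hevD (hh ▸ hev))
    have h2 := hsmall (C \ D1) hD2 (fun hh => by
      have : eu ∈ C \ D1 := hh.symm ▸ heu
      exact this.2 heuD)
    have h3 : D1.ncard + (C \ D1).ncard = C.ncard := by
      rw [add_comm]; exact Set.ncard_diff_add_ncard_of_subset hD1 (Set.toFinite _)
    have hdisj : Disjoint (edgeSupp D1) (edgeSupp (C \ D1)) := by
      rw [Set.disjoint_left]
      rintro x ⟨e, ⟨heC, y, hy, hRy⟩, hx⟩ ⟨f, ⟨hfC, hf⟩, hxf⟩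
      exact hf ⟨hfC, x, hxf, hR e heC y hy x hx hRy⟩
    have h4 := Set.ncard_union_eq hdisj (Set.toFinite _) (Set.toFinite _)
    have h5 : (edgeSupp D1 ∪ edgeSupp (C \ D1)).ncard ≤ (edgeSupp C).ncard :=
      Set.ncard_le_ncard (Set.union_subset (edgeSupp_mono hD1) (edgeSupp_mono hD2))
        (Set.toFinite _)
    omega

lemma exists_bic [Finite V] {G : SimpleGraph V} {D : Set (Sym2 V)} (hDE : D ⊆ G.edgeSet)
    (hD : (edgeSupp D).ncard < D.ncard) : ∃ C ⊆ D, IsBicycle G C := by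
  obtain ⟨D', hD', hc⟩ := exists_conn hD
  obtain ⟨C, hCD, hC⟩ := exists_minimal_le_of_wellFoundedLT
    (fun C : Set (Sym2 V) => EdgeConn C ∧ (edgeSupp C).ncard < C.ncard) D' hc
  refine ⟨C, hCD.trans hD', (hCD.trans hD').trans hDE, Set.toFinite _, hC.prop.1, hC.prop.2, ?_⟩
  rintro X hX ⟨x1, -, x2⟩
  exact hX.2 (hC.le_of_le ⟨x1, x2⟩ hX.1)

lemma match_no_bic [Finite V] {G : SimpleGraph V} {K : Set V} {f : V → Sym2 V}
    (hf : ∀ v ∈ K, v ∈ f v) {C : Set (Sym2 V)} (hC : C ⊆ f '' K) : ¬ IsBicycle G C := by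
  rintro ⟨-, -, -, h, -⟩
  have h1 : C ⊆ f '' (K ∩ f ⁻¹' C) := by
    intro e he
    obtain ⟨v, hv, rfl⟩ := hC he
    exact ⟨v, ⟨hv, he⟩, rfl⟩
  have h2 := Set.ncard_le_ncard h1 (Set.toFinite _)
  have h3 := Set.ncard_image_le (f := f) (Set.toFinite (K ∩ f ⁻¹' C))
  have h4 : (K ∩ f ⁻¹' C).ncard ≤ (edgeSupp C).ncard :=
    Set.ncard_le_ncard (fun v hv => ⟨f v, hv.2, hf v hv.1⟩) (Set.toFinite _)
  omega

lemma bic_match [Finite V] {G : SimpleGraph V} {C : Set (Sym2 V)} (hC : IsBicycle G C) :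
    ∃ f : V → Sym2 V, Set.InjOn f (edgeSupp C) ∧ ∀ v ∈ edgeSupp C, v ∈ f v ∧ f v ∈ C := by
  classical
  have := Fintype.ofFinite V
  obtain ⟨-, -, hc, hlt, hmin⟩ := hC
  obtain ⟨e, he⟩ := hc.1
  let D : Set (Sym2 V) := C \ {e}
  have hDC : D ⊆ C := Set.diff_subset
  have hsm : ∀ X ⊆ D, X.ncard ≤ (edgeSupp X).ncard := by
    intro X hX
    by_contra hcon
    push Not at hcon
    obtain ⟨Y, hY, hY1, hY2⟩ := exists_conn hcon
    refine hmin Y ⟨(hY.trans hX).trans hDC, fun hh => ?_⟩ ⟨hY1, Set.toFinite _, hY2⟩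
    exact (hX (hY (hh he))).2 rfl
  have hall := (Finset.all_card_le_biUnion_card_iff_exists_injective
    (fun d : D => Finset.univ.filter (fun v : V => v ∈ (d : Sym2 V)))).1 (by
      intro s
      have h1 := hsm ((fun d : D => (d : Sym2 V)) '' (s : Set D)) (by
        rintro _ ⟨d, -, rfl⟩; exact d.2)
      rw [Set.ncard_image_of_injective _ Subtype.val_injective, Set.ncard_coe_finset] at h1
      refine h1.trans ?_
      rw [← Set.ncard_coe_finset]
      refine Set.ncard_le_ncard ?_ (Set.toFinite _)
      rintro v ⟨_, ⟨d, hd, rfl⟩, hv⟩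
      simp only [Finset.coe_biUnion, Set.mem_iUnion]
      exact ⟨d, hd, by simpa using hv⟩)
  obtain ⟨g, hg, hgm⟩ := hall
  have hgm' : ∀ d : D, g d ∈ (d : Sym2 V) := fun d => by simpa using hgm d
  let g' : D → edgeSupp C := fun d => ⟨g d, d, hDC d.2, hgm' d⟩
  have hg' : Function.Injective g' := fun a b hab => hg (congrArg Subtype.val hab)
  have hcard : Nat.card (edgeSupp C) ≤ Nat.card D := by
    rw [Nat.card_coe_set_eq, Nat.card_coe_set_eq]
    have := Set.ncard_diff_singleton_add_one he (Set.toFinite _)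
    change _ ≤ (C \ {e}).ncard
    omega
  have hbij : Function.Bijective g' := hg'.bijective_of_nat_card_le hcard
  choose k hk using hbij.2
  refine ⟨fun v => if h : v ∈ edgeSupp C then (k ⟨v, h⟩ : Sym2 V) else e, ?_, ?_⟩
  · intro a ha b hb hab
    simp only [ha, hb, dif_pos] at hab
    have h1 := Subtype.val_injective hab
    have h2 := congrArg g' h1
    rw [hk, hk] at h2
    exact congrArg Subtype.val h2
  · intro v hv
    simp only [hv, dif_pos]
    refine ⟨?_, hDC (k ⟨v, hv⟩).2⟩
    have h1 := hgm' (k ⟨v, hv⟩)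
    have h2 : g (k ⟨v, hv⟩) = v := congrArg Subtype.val (hk ⟨v, hv⟩)
    rwa [h2] at h1

/-- A coloop-free set with full support contains a perfect vertex-to-edge matching. -/
lemma span_match [Finite V] {G : SimpleGraph V} {F : Set (Sym2 V)}
    (hF : ∀ e ∈ F, ∃ C, IsBicycle G C ∧ C ⊆ F ∧ e ∈ C) (hs : ∀ v, ∃ e ∈ F, v ∈ e) :
    ∃ f : V → Sym2 V, Function.Injective f ∧ ∀ v, v ∈ f v ∧ f v ∈ F := by
  classical
  let Good : Set V → Prop := fun K => ∃ f : V → Sym2 V, Set.InjOn f K ∧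
    ∀ v ∈ K, v ∈ f v ∧ f v ∈ F ∧ ∀ x ∈ f v, x ∈ K
  have h0 : Good ∅ := ⟨fun v => s(v, v), by simp, by simp⟩
  obtain ⟨K, -, hK⟩ := exists_maximal_ge_of_wellFoundedGT Good ∅ h0
  have hKu : ∀ v, v ∈ K := by
    intro v
    obtain ⟨e, he, hve⟩ := hs v
    obtain ⟨C, hC, hCF, heC⟩ := hF e he
    obtain ⟨f, hf1, hf2⟩ := hK.prop
    obtain ⟨g, hg1, hg2⟩ := bic_match hC
    have hgood : Good (K ∪ edgeSupp C) := by
      refine ⟨fun v => if v ∈ K then f v else g v, ?_, ?_⟩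
      · intro a ha b hb hab
        by_cases haK : a ∈ K <;> by_cases hbK : b ∈ K <;>
          simp only [haK, hbK, if_true, if_false] at hab
        · exact hf1 haK hbK hab
        · have hbC : b ∈ edgeSupp C := hb.resolve_left hbK
          exact absurd ((hf2 a haK).2.2 b (hab ▸ (hg2 b hbC).1)) hbK
        · have haC : a ∈ edgeSupp C := ha.resolve_left haK
          exact absurd ((hf2 b hbK).2.2 a (hab ▸ (hg2 a haC).1)) haK
        · exact hg1 (ha.resolve_left haK) (hb.resolve_left hbK) hab
      · intro a ha
        by_cases haK : a ∈ K
        · simp only [haK, if_true]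
          exact ⟨(hf2 a haK).1, (hf2 a haK).2.1, fun x hx => Or.inl ((hf2 a haK).2.2 x hx)⟩
        · simp only [haK, if_false]
          have haC : a ∈ edgeSupp C := ha.resolve_left haK
          exact ⟨(hg2 a haC).1, hCF (hg2 a haC).2, fun x hx => Or.inr ⟨_, (hg2 a haC).2, hx⟩⟩
    exact hK.le_of_ge hgood Set.subset_union_left (Or.inr ⟨e, heC, hve⟩)
  obtain ⟨f, hf1, hf2⟩ := hK.prop
  exact ⟨f, fun a b hab => hf1 (hKu a) (hKu b) hab, fun v => ⟨(hf2 v (hKu v)).1, (hf2 v (hKu v)).2.1⟩⟩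

/-- A connected graph with at least as many edges as vertices has a vertex-to-edge matching. -/
lemma conn_match [Fintype V] (H : SimpleGraph V) (W : Set V)
    (hr : ∀ a ∈ W, ∀ b ∈ W, H.Reachable a b)
    (ht : ∀ e ∈ H.edgeSet, ∃ x ∈ e, x ∈ W) (hcard : W.ncard ≤ H.edgeSet.ncard) :
    ∃ f : V → Sym2 V, Set.InjOn f W ∧ ∀ v ∈ W, v ∈ f v ∧ f v ∈ H.edgeSet := by
  classical
  have hall := (Finset.all_card_le_biUnion_card_iff_exists_injective
    (fun w : W => Finset.univ.filter (fun e : Sym2 V => (w : V) ∈ e ∧ e ∈ H.edgeSet))).1 (by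
      intro s
      by_cases hs : ∀ w : W, w ∈ s
      · have h1 : s.card = W.ncard := by
          have : s = Finset.univ := Finset.eq_univ_of_forall hs
          rw [this, Finset.card_univ, ← Nat.card_eq_fintype_card, Nat.card_coe_set_eq]
        rw [h1]
        refine hcard.trans ?_
        rw [← Set.ncard_coe_finset]
        refine Set.ncard_le_ncard ?_ (Set.toFinite _)
        intro e he
        obtain ⟨x, hx, hxW⟩ := ht e he
        simp only [Finset.coe_biUnion, Set.mem_iUnion]
        exact ⟨⟨x, hxW⟩, hs _, by simpa using ⟨hx, he⟩⟩
      · push Not at hs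
        obtain ⟨r, hrs⟩ := hs
        have hpar : ∀ x : W, ∃ y : V, x ∈ s → H.Adj x y ∧ H.dist y r < H.dist x r := by
          intro x
          by_cases hx : x ∈ s
          · obtain ⟨p, hp⟩ := (hr x x.2 r r.2).exists_walk_length_eq_dist
            have hne : (x : V) ≠ r := fun hh => hrs (Subtype.ext hh ▸ hx)
            revert hp
            generalize (x : V) = x' at p hne
            intro hp
            cases p with
            | nil => exact absurd rfl hne
            | cons h q =>
              rename_i y
              refine ⟨y, fun _ => ⟨h, ?_⟩⟩
              have := SimpleGraph.dist_le q
              rw [SimpleGraph.Walk.length_cons] at hp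
              omega
          · exact ⟨r, fun h => absurd h hx⟩
        choose y hy using hpar
        refine Finset.card_le_card_of_injOn (fun x => s((x : V), y x)) ?_ ?_
        · intro x hx
          have hx' : x ∈ s := hx
          simp only [Finset.coe_biUnion, Set.mem_iUnion]
          exact ⟨x, hx, by simpa using (hy x hx').1⟩
        · intro a ha b hb hab
          rcases Sym2.eq_iff.1 hab with ⟨h1, -⟩ | ⟨h1, h2⟩
          · exact Subtype.ext h1
          · have h3 := (hy a ha).2
            have h4 := (hy b hb).2
            rw [h2] at h3
            rw [← h1] at h4
            omega)
  obtain ⟨g, hg, hgm⟩ := hall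
  have hgm' : ∀ w : W, (w : V) ∈ g w ∧ g w ∈ H.edgeSet := fun w => by simpa using hgm w
  refine ⟨fun v => if h : v ∈ W then g ⟨v, h⟩ else s(v, v), ?_, ?_⟩
  · intro a ha b hb hab
    simp only [ha, hb, dif_pos] at hab
    exact congrArg Subtype.val (hg hab)
  · intro v hv
    simp only [hv, dif_pos]
    exact hgm' ⟨v, hv⟩

lemma fromEdgeSet_eq {G : SimpleGraph V} {C : Set (Sym2 V)} (hC : C ⊆ G.edgeSet) :
    (SimpleGraph.fromEdgeSet C).edgeSet = C := by
  rw [SimpleGraph.edgeSet_fromEdgeSet]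
  ext e
  exact ⟨fun h => h.1, fun h => ⟨h, G.not_isDiag_of_mem_edgeSet (hC h)⟩⟩

lemma edgeSupp_delE_lt [Fintype V] {G : SimpleGraph V} {v : V} {I : Set (Sym2 V)}
    (hI : I ⊆ delE G v) : (edgeSupp I).ncard < Fintype.card V := by
  rw [← Nat.card_eq_fintype_card, ← Set.ncard_univ]
  refine Set.ncard_lt_ncard ⟨Set.subset_univ _, fun h => ?_⟩ (Set.toFinite _)
  obtain ⟨e, he, hve⟩ := h (Set.mem_univ v)
  exact (hI he).2 hve

lemma good_coloopfree [Fintype V] {G : SimpleGraph V} (h : Conn3 G) (hV : 5 ≤ Fintype.card V)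
    {v : V} (hv : Fintype.card V ≤ (delE G v).ncard) {e : Sym2 V} (he : e ∈ delE G v) :
    ∃ C, IsBicycle G C ∧ C ⊆ delE G v ∧ e ∈ C := by
  classical
  let D : Set (Sym2 V) := delE G v \ {e}
  have hDd : D ⊆ delE G v := Set.diff_subset
  have hDE : D ⊆ G.edgeSet := fun f hf => (hDd hf).1
  have hedge := fromEdgeSet_eq hDE
  have hWc : ({v}ᶜ : Set V).ncard + 1 = Fintype.card V := by
    have := Set.ncard_add_ncard_compl ({v} : Set V)
    rw [Set.ncard_singleton, Nat.card_eq_fintype_card] at this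
    omega
  have hDc : D.ncard + 1 = (delE G v).ncard := Set.ncard_diff_singleton_add_one he (Set.toFinite _)
  have hr : ∀ a ∈ ({v}ᶜ : Set V), ∀ b ∈ ({v}ᶜ : Set V),
      (SimpleGraph.fromEdgeSet D).Reachable a b := by
    induction e with
    | _ x y =>
    have hxv := he.2
    simp only [Sym2.mem_iff, not_or] at hxv
    have hxy : x ≠ y := G.ne_of_adj he.1
    have h1 : ∀ a b, a ≠ v → b ≠ v → a ≠ x → b ≠ x →
        (SimpleGraph.fromEdgeSet D).Reachable a b := by
      intro a b hav hbv hax hbx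
      obtain ⟨p, -, hpv, hpx⟩ := h v x a b hav hax hbv hbx
      refine ⟨p.transfer _ fun f hf => ?_⟩
      rw [hedge]
      refine ⟨⟨p.edges_subset_edgeSet hf, fun hvf => ?_⟩, ?_⟩
      · obtain ⟨z, rfl⟩ := Sym2.mem_iff_exists.1 hvf
        exact hpv (p.fst_mem_support_of_mem_edges hf)
      · rintro rfl
        exact hpx (p.fst_mem_support_of_mem_edges hf)
    obtain ⟨z, hz, hzv, hzy⟩ := exists_nbr h hV x v y (Ne.symm hxv.1) hxy
    have h2 : (SimpleGraph.fromEdgeSet D).Reachable x z := by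
      refine SimpleGraph.Adj.reachable ?_
      rw [SimpleGraph.fromEdgeSet_adj]
      refine ⟨⟨⟨hz, ?_⟩, ?_⟩, hz.ne⟩
      · simp [hxv.1, hzv.symm]
      · intro hh
        exact hzy (Sym2.congr_right.1 hh)
    have h3 : ∀ a, a ≠ v → (SimpleGraph.fromEdgeSet D).Reachable a z := by
      intro a ha
      by_cases hax : a = x
      · exact hax ▸ h2
      · exact h1 a z ha hzv hax hz.ne.symm
    intro a ha b hb
    exact (h3 a ha).trans (h3 b hb).symm
  obtain ⟨f, hf1, hf2⟩ := conn_match (SimpleGraph.fromEdgeSet D) {v}ᶜ hr (by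
    rw [hedge]
    intro f hf
    induction f with
    | _ a b =>
    refine ⟨a, by simp, fun hav => (hDd hf).2 ?_⟩
    rw [Set.mem_singleton_iff] at hav
    simp [hav]) (by rw [hedge]; omega)
  rw [hedge] at hf2
  let I : Set (Sym2 V) := f '' {v}ᶜ
  have hID : I ⊆ D := by rintro _ ⟨x, hx, rfl⟩; exact (hf2 x hx).2
  have heI : e ∉ I := fun hh => (hID hh).2 rfl
  have hIc : I.ncard = ({v}ᶜ : Set V).ncard := Set.ncard_image_of_injOn hf1
  have hJ : insert e I ⊆ delE G v := Set.insert_subset he (hID.trans hDd)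
  have hJc := Set.ncard_insert_of_notMem heI (Set.toFinite _)
  have hJs := edgeSupp_delE_lt hJ
  obtain ⟨C, hCJ, hC⟩ := exists_bic (G := G) (D := insert e I) (fun x hx => (hJ hx).1) (by omega)
  refine ⟨C, hC, hCJ.trans hJ, ?_⟩
  by_contra heC
  refine match_no_bic (fun v hv => (hf2 v hv).1) (fun x hx => ?_) hC
  exact (hCJ hx).resolve_left (fun hh => heC (hh ▸ hx))

lemma delE_adj {G : SimpleGraph V} {v a b : V} :
    (SimpleGraph.fromEdgeSet (delE G v)).Adj a b ↔ G.Adj a b ∧ v ≠ a ∧ v ≠ b := by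
  rw [SimpleGraph.fromEdgeSet_adj]
  simp only [delE, Set.mem_ofPred_eq, SimpleGraph.mem_edgeSet, Sym2.mem_iff, not_or]
  exact ⟨fun h => h.1, fun h => ⟨h, h.1.ne⟩⟩

open Classical in
lemma sum_deg [Fintype V] {G : SimpleGraph V} {C : Set (Sym2 V)} (hC : C ⊆ G.edgeSet) :
    ∑ u, (SimpleGraph.fromEdgeSet C).degree u = 2 * C.ncard := by
  rw [SimpleGraph.sum_degrees_eq_twice_card_edges]
  congr 1
  rw [← Set.ncard_coe_finset, SimpleGraph.coe_edgeFinset, fromEdgeSet_eq hC]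

open Classical in
lemma bad_degree [Fintype V] {G : SimpleGraph V} (h : Conn3 G) (hV : 5 ≤ Fintype.card V)
    {v : V} (hv : (delE G v).ncard < Fintype.card V) (u : V) (hu : u ≠ v) :
    (SimpleGraph.fromEdgeSet (delE G v)).degree u = 2 := by
  have hsum := sum_deg (G := G) (C := delE G v) (fun e he => he.1)
  have hge : ∀ u ∈ Finset.univ.erase v, 2 ≤ (SimpleGraph.fromEdgeSet (delE G v)).degree u := by
    intro u hu
    have hu' : u ≠ v := Finset.ne_of_mem_erase hu
    obtain ⟨y, hy, hyv, -⟩ := exists_nbr h hV u v v hu' hu'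
    obtain ⟨z, hz, hzv, hzy⟩ := exists_nbr h hV u v y hu' hy.ne
    have hsub : ({y, z} : Finset V) ⊆ (SimpleGraph.fromEdgeSet (delE G v)).neighborFinset u := by
      intro x hx
      rw [SimpleGraph.mem_neighborFinset, delE_adj]
      simp only [Finset.mem_insert, Finset.mem_singleton] at hx
      rcases hx with rfl | rfl
      · exact ⟨hy, hu'.symm, hyv.symm⟩
      · exact ⟨hz, hu'.symm, hzv.symm⟩
    have := Finset.card_le_card hsub
    rwa [Finset.card_pair hzy.symm, SimpleGraph.card_neighborFinset_eq_degree] at this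
  have h1 : ∑ u ∈ Finset.univ.erase v, 2 ≤
      ∑ u ∈ Finset.univ.erase v, (SimpleGraph.fromEdgeSet (delE G v)).degree u :=
    Finset.sum_le_sum hge
  have h2 : ∑ u ∈ Finset.univ.erase v, (SimpleGraph.fromEdgeSet (delE G v)).degree u ≤
      ∑ u, (SimpleGraph.fromEdgeSet (delE G v)).degree u :=
    Finset.sum_le_sum_of_subset (Finset.erase_subset _ _)
  have h3 : ∑ u ∈ Finset.univ.erase v, 2 = 2 * (Fintype.card V - 1) := by
    rw [Finset.sum_const, Finset.card_erase_of_mem (Finset.mem_univ v), Finset.card_univ,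
      smul_eq_mul, mul_comm]
  have h4 := (Finset.sum_eq_sum_iff_of_le hge).1 (by omega)
  exact (h4 u (Finset.mem_erase.2 ⟨hu, Finset.mem_univ _⟩)).symm

open Classical in
lemma bad_adj [Fintype V] {G : SimpleGraph V} (h : Conn3 G) (hV : 5 ≤ Fintype.card V)
    {v : V} (hv : (delE G v).ncard < Fintype.card V) (u : V) (hu : u ≠ v) : G.Adj u v := by
  have hd := bad_degree h hV hv u hu
  rw [← SimpleGraph.card_neighborFinset_eq_degree, Finset.card_eq_two] at hd
  obtain ⟨s, t, -, hst⟩ := hd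
  have hs : s ∈ (SimpleGraph.fromEdgeSet (delE G v)).neighborFinset u := by rw [hst]; simp
  have ht : t ∈ (SimpleGraph.fromEdgeSet (delE G v)).neighborFinset u := by rw [hst]; simp
  rw [SimpleGraph.mem_neighborFinset] at hs ht
  obtain ⟨y, hy, hys, hyt⟩ := exists_nbr h hV u s t hs.ne ht.ne
  by_cases hyv : y = v
  · exact hyv ▸ hy
  · have : y ∈ (SimpleGraph.fromEdgeSet (delE G v)).neighborFinset u := by
      rw [SimpleGraph.mem_neighborFinset, delE_adj]
      exact ⟨hy, hu.symm, fun hh => hyv hh.symm⟩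
    rw [hst] at this
    simp [hys, hyt] at this

lemma bad_unique [Fintype V] {G : SimpleGraph V} (h : Conn3 G) (hV : 5 ≤ Fintype.card V)
    {a b : V} (ha : (delE G a).ncard < Fintype.card V) (hb : (delE G b).ncard < Fintype.card V) :
    a = b := by
  classical
  by_contra hab
  have hd := bad_degree h hV ha b (Ne.symm hab)
  rw [← SimpleGraph.card_neighborFinset_eq_degree] at hd
  have hsub : (Finset.univ.erase a).erase b ⊆
      (SimpleGraph.fromEdgeSet (delE G a)).neighborFinset b := by
    intro x hx
    simp only [Finset.mem_erase, Finset.mem_univ, and_true] at hx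
    rw [SimpleGraph.mem_neighborFinset, delE_adj]
    exact ⟨(bad_adj h hV hb x hx.1).symm, hab, Ne.symm hx.2⟩
  have h1 := Finset.card_le_card hsub
  rw [Finset.card_erase_of_mem (by simp [Ne.symm hab]), Finset.card_erase_of_mem (by simp),
    Finset.card_univ, hd] at h1
  omega

lemma bad_no_bic [Fintype V] {G : SimpleGraph V} (h : Conn3 G) (hV : 5 ≤ Fintype.card V)
    {v : V} (hv : (delE G v).ncard < Fintype.card V) {C : Set (Sym2 V)} (hC : C ⊆ delE G v) :
    ¬ IsBicycle G C := by
  classical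
  rintro ⟨hCE, -, -, hlt, -⟩
  have hsum := sum_deg hCE
  have hle : ∀ u, (SimpleGraph.fromEdgeSet C).degree u ≤ if u ∈ edgeSupp C then 2 else 0 := by
    intro u
    by_cases hu : u ∈ edgeSupp C
    · rw [if_pos hu]
      obtain ⟨e, he, hue⟩ := hu
      have huv : u ≠ v := by rintro rfl; exact (hC he).2 hue
      rw [← bad_degree h hV hv u huv]
      exact SimpleGraph.degree_le_of_le (SimpleGraph.fromEdgeSet_mono hC)
    · rw [if_neg hu, Nat.le_zero, ← SimpleGraph.card_neighborFinset_eq_degree,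
        Finset.card_eq_zero, Finset.eq_empty_iff_forall_notMem]
      intro x hx
      rw [SimpleGraph.mem_neighborFinset, SimpleGraph.fromEdgeSet_adj] at hx
      exact hu ⟨_, hx.1, by simp⟩
  have h1 := Finset.sum_le_sum (s := Finset.univ) (fun u _ => hle u)
  have h2 : ∑ u, (if u ∈ edgeSupp C then 2 else 0) = 2 * (edgeSupp C).ncard := by
    rw [← Finset.sum_filter, Finset.sum_const, smul_eq_mul, mul_comm,
      ← Set.ncard_coe_finset]
    congr 2
    ext x; simp
  omega

lemma isGA_of_B [Fintype V] {G : SimpleGraph V} (h : Conn3 G) (hV : 5 ≤ Fintype.card V)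
    {B : Matroid (Sym2 V)} (hBE : B.E = G.edgeSet)
    (hBC : ∀ C : Set (Sym2 V), MCirc B C ↔ IsBicycle G C)
    {σ : Equiv.Perm (Sym2 V)} (hσ : IsMAuto B σ) : IsGA G σ := by
  classical
  have hbad : ∀ a ∉ {v : V | Fintype.card V ≤ (delE G v).ncard},
      ∀ b ∉ {v : V | Fintype.card V ≤ (delE G v).ncard}, a = b := fun a ha b hb =>
    bad_unique h hV (not_le.1 ha) (not_le.1 hb)
  refine isGA_of_family hBE {v | Fintype.card V ≤ (delE G v).ncard} (FamB B (Fintype.card V))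
    hbad (sep_of h hV) ?_ ?_ (fun τ hτ F hF => famB_inv hτ F hF) hσ
  · intro v hv
    refine ⟨by rw [hBE]; exact fun e he => he.1, fun e he => ?_, fun I hI hind => ?_⟩
    · obtain ⟨C, hC, h1, h2⟩ := good_coloopfree h hV hv he
      exact ⟨C, (hBC C).2 hC, h1, h2⟩
    · by_contra hcon
      have h1 := edgeSupp_delE_lt hI
      obtain ⟨C, hCI, hC⟩ := exists_bic (G := G) (D := I) (fun e he => (hI he).1) (by omega)
      exact ((indep_iff_circ B I).1 hind).2 C hCI ((hBC C).2 hC)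
  · rintro F ⟨f1, f2, f3⟩
    have f2' : ∀ e ∈ F, ∃ C, IsBicycle G C ∧ C ⊆ F ∧ e ∈ C := by
      intro e he
      obtain ⟨C, hC, h1, h2⟩ := f2 e he
      exact ⟨C, (hBC C).1 hC, h1, h2⟩
    have hex : ∃ v, F ⊆ delE G v := by
      by_contra hcon
      push Not at hcon
      obtain ⟨f, hf1, hf2⟩ := span_match f2' (by
        intro v
        by_contra hn
        push Not at hn
        exact hcon v fun e he => ⟨by rw [← hBE]; exact f1 he, hn e he⟩)
      have hI : f '' Set.univ ⊆ F := by rintro _ ⟨v, -, rfl⟩; exact (hf2 v).2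
      have := f3 _ hI ((indep_iff_circ _ _).2 ⟨hI.trans f1, fun C hC hm =>
        match_no_bic (fun v _ => (hf2 v).1) hC ((hBC C).1 hm)⟩)
      rw [Set.ncard_image_of_injective _ hf1, Set.ncard_univ, Nat.card_eq_fintype_card] at this
      exact lt_irrefl _ this
    obtain ⟨v, hv⟩ := hex
    by_cases hvP : v ∈ {v : V | Fintype.card V ≤ (delE G v).ncard}
    · exact ⟨v, hvP, hv⟩
    · have : Nontrivial V := Fintype.one_lt_card_iff_nontrivial.1 (by omega)
      obtain ⟨w, hw⟩ := exists_ne v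
      refine ⟨w, ?_, fun e he => ?_⟩
      · by_contra hwP
        exact hw (hbad w hwP v hvP)
      · obtain ⟨C, hC, hCF, -⟩ := f2' e he
        exact absurd hC (bad_no_bic h hV (not_le.1 hvP) (hCF.trans hv))

end GraphPart

/-- If `G` is a 3-connected graph with at least 5 vertices, the fixing numbers of the
cycle matroid `M(G)` and the bicircular matroid `B(G)` are equal. -/
theorem stmt15 {V : Type*} [Fintype V] (G : SimpleGraph V)
    (h3 : ThreeConnected G) (hV : 5 ≤ Fintype.card V)
    (M : Matroid (Sym2 V)) (hME : M.E = G.edgeSet)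
    (hMC : ∀ C : Set (Sym2 V), MCirc M C ↔ IsCycleSet G C)
    (B : Matroid (Sym2 V)) (hBE : B.E = G.edgeSet)
    (hBC : ∀ C : Set (Sym2 V), MCirc B C ↔ IsBicycle G C) :
    fixNum M = fixNum B := by
  have hc := conn3_of h3
  have key : ∀ σ, IsMAuto M σ ↔ IsMAuto B σ := fun σ =>
    ⟨fun h => isGA_auto (isGA_of_M hc hV hME hMC h) B hBE (Or.inr hBC),
      fun h => isGA_auto (isGA_of_B hc hV hBE hBC h) M hME (Or.inl hMC)⟩
  have hfix : ∀ A, IsFixingSet M A ↔ IsFixingSet B A := by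
    intro A
    unfold IsFixingSet
    rw [hME, hBE]
    simp only [key]
  unfold fixNum
  simp only [hfix]
end
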